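/- arXiv:1502.06839 — 8 statements merged into one kernel-verified Lean document; each statement's English description precedes it below -/
import Mathlib

section
/- Let X and Y be Polish spaces, let μ be a Borel probability measure on X and ν a Borel probability measure on Y, and let c : X × Y → ℝ be a lower semicontinuous cost function that is bounded below. Then there exists a transport plan γ* ∈ ADM(μ,ν) minimizing ∫_{X×Y} c dγ over all γ ∈ ADM(μ,ν). -/
open MeasureTheory Filter Topology

/-- The functional `γ ↦ ∫ f dγ` is lower semicontinuous for the topology of convergence in
distribution whenever `f` is nonnegative and lower semicontinuous. -/
theorem lowerSemicontinuous_lintegral_ofReal {Ω : Type*} [TopologicalSpace Ω]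
    [TopologicalSpace.PseudoMetrizableSpace Ω] [TopologicalSpace.SeparableSpace Ω]
    [MeasurableSpace Ω] [BorelSpace Ω]
    {f : Ω → ℝ} (hf : LowerSemicontinuous f) (f_nonneg : 0 ≤ f) :
    LowerSemicontinuous fun γ : ProbabilityMeasure Ω =>
      ∫⁻ x, ENNReal.ofReal (f x) ∂(γ : Measure Ω) := by
  rw [lowerSemicontinuous_iff_le_liminf]
  intro γ
  simp_rw [lintegral_eq_lintegral_meas_lt _ (Eventually.of_forall f_nonneg)
    hf.measurable.aemeasurable]
  calc ∫⁻ t in Set.Ioi (0 : ℝ), (γ : Measure Ω) {x | t < f x}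
      ≤ ∫⁻ t in Set.Ioi (0 : ℝ),
          liminf (fun γ' : ProbabilityMeasure Ω => (γ' : Measure Ω) {x | t < f x}) (𝓝 γ) :=
        lintegral_mono fun t =>
          ProbabilityMeasure.le_liminf_measure_open_of_tendsto tendsto_id (hf.isOpen_preimage t)
    _ ≤ _ := lintegral_liminf_le fun γ' => Antitone.measurable fun s t hst =>
        measure_mono fun x hx => lt_of_le_of_lt hst hx

/-- The set of transport plans between two Borel probability measures on Polish spaces is compact
for the topology of convergence in distribution. -/
theorem isCompact_setOf_map_fst_eq_map_snd_eq {X Y : Type*}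
    [TopologicalSpace X] [PolishSpace X] [MeasurableSpace X] [BorelSpace X]
    [TopologicalSpace Y] [PolishSpace Y] [MeasurableSpace Y] [BorelSpace Y]
    (μ : ProbabilityMeasure X) (ν : ProbabilityMeasure Y) :
    IsCompact {γ : ProbabilityMeasure (X × Y) |
      γ.map measurable_fst.aemeasurable = μ ∧ γ.map measurable_snd.aemeasurable = ν} := by
  have closed : IsClosed {γ : ProbabilityMeasure (X × Y) |
      γ.map measurable_fst.aemeasurable = μ ∧ γ.map measurable_snd.aemeasurable = ν} :=
    (isClosed_eq (ProbabilityMeasure.continuous_map continuous_fst) continuous_const).inter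
      (isClosed_eq (ProbabilityMeasure.continuous_map continuous_snd) continuous_const)
  rw [← closed.closure_eq]
  refine isCompact_closure_of_isTightMeasureSet (IsTightMeasureSet.prodMk
    ((isTightMeasureSet_singleton (μ := (μ : Measure X))).subset ?_)
    ((isTightMeasureSet_singleton (μ := (ν : Measure Y))).subset ?_))
  · rintro _ ⟨_, ⟨γ, hγ, rfl⟩, rfl⟩
    exact congrArg ProbabilityMeasure.toMeasure hγ.1
  · rintro _ ⟨_, ⟨γ, hγ, rfl⟩, rfl⟩
    exact congrArg ProbabilityMeasure.toMeasure hγ.2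

/-- **Existence of an optimal transport plan.** Let `X` and `Y` be Polish spaces, `μ`, `ν`
Borel probability measures on `X`, `Y`, and `c : X × Y → ℝ` a lower semicontinuous cost
function bounded below (by `B`). Then there exists a transport plan `γ ∈ ADM(μ,ν)`
minimizing the transport cost over all transport plans.  (The cost is expressed via the
lower integral of the nonnegative function `c - B`, which is equivalent to minimizing
`∫ c dγ` since all plans are probability measures.) -/
theorem stmt_0 {X Y : Type*}
    [TopologicalSpace X] [PolishSpace X] [MeasurableSpace X] [BorelSpace X]
    [TopologicalSpace Y] [PolishSpace Y] [MeasurableSpace Y] [BorelSpace Y]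
    (μ : Measure X) (ν : Measure Y) [IsProbabilityMeasure μ] [IsProbabilityMeasure ν]
    (c : X × Y → ℝ) (hc : LowerSemicontinuous c) (B : ℝ) (hB : ∀ p, B ≤ c p) :
    ∃ γ : Measure (X × Y), IsProbabilityMeasure γ ∧
      γ.map Prod.fst = μ ∧ γ.map Prod.snd = ν ∧
      ∀ γ' : Measure (X × Y), IsProbabilityMeasure γ' →
        γ'.map Prod.fst = μ → γ'.map Prod.snd = ν →
        ∫⁻ p, ENNReal.ofReal (c p - B) ∂γ ≤ ∫⁻ p, ENNReal.ofReal (c p - B) ∂γ' := by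
  have hf : LowerSemicontinuous fun p => c p - B := by
    simpa only [sub_eq_add_neg] using hc.add lowerSemicontinuous_const
  obtain ⟨γ, ⟨hγμ, hγν⟩, hγ⟩ := LowerSemicontinuousOn.exists_isMinOn
    (s := {γ : ProbabilityMeasure (X × Y) |
      γ.map measurable_fst.aemeasurable = ⟨μ, inferInstance⟩ ∧
        γ.map measurable_snd.aemeasurable = ⟨ν, inferInstance⟩})
    ⟨⟨μ.prod ν, inferInstance⟩, Subtype.ext Measure.fst_prod, Subtype.ext Measure.snd_prod⟩
    (isCompact_setOf_map_fst_eq_map_snd_eq _ _)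
    ((lowerSemicontinuous_lintegral_ofReal hf fun p =>
      sub_nonneg.2 (hB p)).lowerSemicontinuousOn _)
  exact ⟨γ, inferInstance, congrArg ProbabilityMeasure.toMeasure hγμ,
    congrArg ProbabilityMeasure.toMeasure hγν, fun γ' hγ' hμ hν =>
      hγ (a := ⟨γ', hγ'⟩) ⟨Subtype.ext hμ, Subtype.ext hν⟩⟩
end

section
/- Let f : [0,1] → [0,1] be a Borel measurable function. There exists a copula measure γ on [0,1]² whose mass is concentrated on the graph of f (i.e., γ({(x, f(x)) : x ∈ [0,1]}) = 1, equivalently γ(G(f)) = 1 for G(f) the graph of f) if and only if f preserves the Lebesgue measure λ on [0,1] (i.e., the pushforward of λ under f equals λ). -/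
open MeasureTheory

/-- The uniform (Lebesgue) measure on `[0,1]`. -/
noncomputable def unif : Measure ℝ := volume.restrict (Set.Icc (0:ℝ) 1)

/-- A copula measure: a Borel probability measure on `[0,1]²` (viewed inside `ℝ × ℝ`)
whose two marginals are the uniform measure on `[0,1]`. -/
def IsCopula (γ : Measure (ℝ × ℝ)) : Prop :=
  IsProbabilityMeasure γ ∧ γ.map Prod.fst = unif ∧ γ.map Prod.snd = unif

/-- **Copulas concentrated on a graph.** Let `f : [0,1] → [0,1]` be Borel measurable.
There exists a copula measure `γ` whose mass is concentrated on the graph of `f`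
(`γ (G f) = 1`) if and only if `f` preserves the Lebesgue measure on `[0,1]`. -/
theorem stmt_3 (f : ℝ → ℝ) (hf : Measurable f)
    (hmaps : Set.MapsTo f (Set.Icc 0 1) (Set.Icc 0 1)) :
    (∃ γ : Measure (ℝ × ℝ), IsCopula γ ∧
        γ {p : ℝ × ℝ | p.1 ∈ Set.Icc (0:ℝ) 1 ∧ p.2 = f p.1} = 1) ↔
      unif.map f = unif := by
  have hmeas : MeasurableSet {p : ℝ × ℝ | p.1 ∈ Set.Icc (0:ℝ) 1 ∧ p.2 = f p.1} :=
    (measurable_fst measurableSet_Icc).inter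
      (measurableSet_eq_fun measurable_snd (hf.comp measurable_fst))
  constructor
  · rintro ⟨γ, ⟨hprob, hfst, hsnd⟩, hγ⟩
    have hae : Prod.snd =ᵐ[γ] f ∘ Prod.fst := by
      filter_upwards [(mem_ae_iff_prob_eq_one hmeas).2 hγ] with p hp using hp.2
    calc unif.map f = γ.map (f ∘ Prod.fst) := by
          rw [← hfst, Measure.map_map hf measurable_fst]
      _ = γ.map Prod.snd := (Measure.map_congr hae).symm
      _ = unif := hsnd
  · intro h
    have hunif : unif (Set.Icc 0 1) = 1 := by simp [unif]
    have hg : Measurable fun x : ℝ => (x, f x) := measurable_id.prodMk hf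
    refine ⟨unif.map fun x => (x, f x), ⟨⟨?_⟩, ?_, ?_⟩, ?_⟩
    · rw [Measure.map_apply hg MeasurableSet.univ]
      simp [unif]
    · rw [Measure.map_map measurable_fst hg]
      exact Measure.map_id
    · rw [Measure.map_map measurable_snd hg]
      exact h
    · rw [Measure.map_apply hg hmeas, ← hunif]
      congr 1
      ext x
      simp
end

section
/- The set of all continuous piecewise linear maps f : [0,1] → [0,1] that preserve the Lebesgue measure on [0,1] is dense, with respect to the supremum norm (uniform convergence), in the set of all continuous maps [0,1] → [0,1] that preserve the Lebesgue measure on [0,1]. -/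
open MeasureTheory

/-- `g` is continuous piecewise linear on `[0,1]`: there is a finite partition
`0 = t 0 < t 1 < ⋯ < t n = 1` of `[0,1]` into intervals on each of which `g` is affine. -/
def IsPiecewiseLinear (g : ℝ → ℝ) : Prop :=
  ∃ (n : ℕ) (t : ℕ → ℝ), 0 < n ∧ t 0 = 0 ∧ t n = 1 ∧ (∀ i < n, t i < t (i + 1)) ∧
    ∀ i < n, ∃ a b : ℝ, ∀ x ∈ Set.Icc (t i) (t (i + 1)), g x = a * x + b

open Set Finset

/-- Cutting an interval along a monotone sequence of points cuts the measure of a set. -/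
lemma volume_inter_Icc_eq_sum (A : Set ℝ) {t : ℕ → ℝ} (ht : Monotone t) (n : ℕ) :
    volume (A ∩ Set.Icc (t 0) (t n)) =
      ∑ i ∈ range n, volume (A ∩ Set.Icc (t i) (t (i + 1))) := by
  induction n with
  | zero => simpa using measure_mono_null Set.inter_subset_right (by simp)
  | succ n ih =>
    rw [sum_range_succ, ← ih,
      ← measure_inter_add_sdiff (A ∩ Set.Icc (t 0) (t (n + 1)))
        (measurableSet_Icc (a := t 0) (b := t n))]
    have h0 : t 0 ≤ t n := ht (Nat.zero_le n)
    have h1 : t n ≤ t (n + 1) := ht n.le_succ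
    have hIoc : volume (A ∩ Set.Ioc (t n) (t (n + 1))) =
        volume (A ∩ Set.Icc (t n) (t (n + 1))) := by
      rw [← Measure.restrict_apply' measurableSet_Ioc, ← Measure.restrict_apply' measurableSet_Icc,
        Measure.restrict_congr_set Ioc_ae_eq_Icc]
    rw [← hIoc]
    congr 2 <;> ext x <;> simp only [Set.mem_inter_iff, Set.mem_sdiff, Set.mem_Icc, Set.mem_Ioc]
    · exact ⟨fun h => ⟨h.1.1, h.2⟩, fun h => ⟨⟨h.1, h.2.1, h.2.2.trans h1⟩, h.2⟩⟩
    · refine ⟨fun h => ⟨h.1.1, ?_, h.1.2.2⟩, fun h => ⟨⟨h.1, h0.trans h.2.1.le, h.2.2⟩, ?_⟩⟩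
      · by_contra! hx
        exact h.2 ⟨h.1.2.1, hx⟩
      · exact fun hx => absurd hx.2 (not_le.2 h.2.1)

lemma volume_affine_preimage_inter_Icc (A : Set ℝ) {a : ℝ} (ha : a ≠ 0) (b p q : ℝ)
    (hpq : p ≤ q) :
    volume ((fun x => a * x + b) ⁻¹' A ∩ Set.Icc p q) =
      ENNReal.ofReal |a⁻¹| * volume (A ∩ Set.uIcc (a * p + b) (a * q + b)) := by
  have hset : (fun x => a * x + b) ⁻¹' A ∩ Set.Icc p q =
      (fun x => a * x) ⁻¹' ((fun x => x + b) ⁻¹' (A ∩ Set.uIcc (a * p + b) (a * q + b))) := by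
    ext x
    simp only [Set.mem_inter_iff, Set.mem_preimage, and_congr_right_iff]
    intro _
    rcases lt_or_gt_of_ne ha with h | h
    · rw [Set.uIcc_of_ge (by nlinarith)]
      simp [h, and_comm]
    · rw [Set.uIcc_of_le (by nlinarith)]
      simp [h]
  rw [hset, Real.volume_preimage_mul_left ha, measure_preimage_add_right]

lemma exists_nat_near_of_parity {M : ℕ} (hM : 0 < M) {y : ℝ} (hy0 : 0 ≤ y) (hyM : y ≤ M)
    (p : ℕ) : ∃ w : ℕ, w ≤ M ∧ w % 2 = p % 2 ∧ |(w : ℝ) - y| ≤ 1 := by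
  have h1 := Nat.floor_le hy0
  have h2 := Nat.lt_floor_add_one y
  by_cases hpar : ⌊y⌋₊ % 2 = p % 2
  · refine ⟨⌊y⌋₊, Nat.floor_le_of_le hyM, hpar, abs_le.2 ⟨by linarith, by linarith⟩⟩
  rcases hyM.eq_or_lt with rfl | hlt
  · rw [Nat.floor_natCast] at hpar
    refine ⟨M - 1, by omega, by omega, ?_⟩
    rw [Nat.cast_sub hM]
    simp
  · refine ⟨⌊y⌋₊ + 1, (Nat.floor_lt hy0).2 hlt, by omega, ?_⟩
    push_cast
    exact abs_le.2 ⟨by linarith, by linarith⟩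

/-- The fraction of the first `n` steps of the walk `w` that stay weakly below level `k`. -/
noncomputable def stepCDF (n : ℕ) (w : ℕ → ℕ) (k : ℕ) : ℝ :=
  (#{i ∈ range n | min (w i) (w (i + 1)) < k} : ℝ) / n

/-- The continuous function with value `v i` at `i / n` for `i ≤ n`, affine in between. -/
noncomputable def gridInterp (n : ℕ) (v : ℕ → ℝ) (x : ℝ) : ℝ :=
  v 0 + ∑ i ∈ range n, (v (i + 1) - v i) * max 0 (min 1 (n * x - i))

lemma continuous_gridInterp (n : ℕ) (v : ℕ → ℝ) : Continuous (gridInterp n v) := by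
  unfold gridInterp
  fun_prop

lemma gridInterp_eq {n : ℕ} (v : ℕ → ℝ) {j : ℕ} (hj : j < n) {x : ℝ}
    (h0 : (j : ℝ) ≤ n * x) (h1 : n * x ≤ j + 1) :
    gridInterp n v x = v j + (v (j + 1) - v j) * (n * x - j) := by
  have hlow : ∑ i ∈ range j, (v (i + 1) - v i) * max 0 (min 1 (n * x - i)) = v j - v 0 := by
    rw [← sum_range_sub]
    refine sum_congr rfl fun i hi => ?_
    have : (i : ℝ) + 1 ≤ j := by exact_mod_cast mem_range.1 hi
    rw [min_eq_left (by linarith), max_eq_right zero_le_one, mul_one]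
  have hhigh : ∑ i ∈ Ico (j + 1) n, (v (i + 1) - v i) * max 0 (min 1 (n * x - i)) = 0 := by
    refine sum_eq_zero fun i hi => ?_
    have : (j : ℝ) + 1 ≤ i := by exact_mod_cast (mem_Ico.1 hi).1
    rw [max_eq_left (min_le_of_right_le (by linarith)), mul_zero]
  rw [gridInterp, ← sum_range_add_sum_Ico _ (Nat.succ_le_of_lt hj), hhigh, sum_range_succ, hlow,
    min_eq_right (by linarith), max_eq_right (by linarith)]
  ring

lemma exists_grid_cell {n : ℕ} (hn : 0 < n) {x : ℝ} (hx : x ∈ Set.Icc (0 : ℝ) 1) :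
    ∃ j < n, (j : ℝ) ≤ n * x ∧ n * x ≤ j + 1 := by
  have hn' : (0 : ℝ) < n := by exact_mod_cast hn
  have hnx : 0 ≤ n * x := mul_nonneg hn'.le hx.1
  rcases hx.2.eq_or_lt with rfl | hlt
  · exact ⟨n - 1, by omega, by rw [Nat.cast_sub hn]; simp, by rw [Nat.cast_sub hn]; simp⟩
  · exact ⟨⌊n * x⌋₊, (Nat.floor_lt hnx).2 (by nlinarith), Nat.floor_le hnx,
      (Nat.lt_floor_add_one _).le⟩

lemma isPiecewiseLinear_gridInterp {n : ℕ} (hn : 0 < n) (v : ℕ → ℝ) :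
    IsPiecewiseLinear (gridInterp n v) := by
  have hn' : (0 : ℝ) < n := by exact_mod_cast hn
  refine ⟨n, fun i => i / n, hn, by simp, div_self hn'.ne', fun i _ => ?_, fun i hi => ?_⟩
  · push_cast
    gcongr
    linarith
  · refine ⟨(v (i + 1) - v i) * n, v i - (v (i + 1) - v i) * i, fun x hx => ?_⟩
    rw [Set.mem_Icc, div_le_iff₀' hn', le_div_iff₀' hn'] at hx
    rw [gridInterp_eq v hi hx.1 (by exact_mod_cast hx.2)]
    ring

lemma stepCDF_mono (n : ℕ) (w : ℕ → ℕ) : Monotone (stepCDF n w) := by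
  intro k l hkl
  unfold stepCDF
  gcongr

lemma stepCDF_zero (n : ℕ) (w : ℕ → ℕ) : stepCDF n w 0 = 0 := by
  simp [stepCDF]

lemma stepCDF_succ (n : ℕ) (w : ℕ → ℕ) (k : ℕ) :
    stepCDF n w (k + 1) =
      stepCDF n w k + (#{i ∈ range n | min (w i) (w (i + 1)) = k} : ℝ) / n := by
  unfold stepCDF
  rw [← add_div, ← Nat.cast_add, ← card_union_of_disjoint, ← filter_or]
  · simp only [Nat.lt_succ_iff_lt_or_eq]
  · exact disjoint_filter.2 fun i _ h => h.ne

lemma stepCDF_eq_one {n M : ℕ} (hn : 0 < n) {w : ℕ → ℕ}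
    (hlow : ∀ i < n, min (w i) (w (i + 1)) < M) : stepCDF n w M = 1 := by
  rw [stepCDF, filter_true_of_mem fun i hi => hlow i (mem_range.1 hi), card_range]
  exact div_self (by exact_mod_cast hn.ne')

lemma min_lt_of_step {a b M : ℕ} (h : b = a + 1 ∨ a = b + 1) (ha : a ≤ M) (hb : b ≤ M) :
    min a b < M := by omega

lemma volume_inter_Icc_grid (A : Set ℝ) {n : ℕ} (hn : 0 < n) :
    volume (A ∩ Set.Icc 0 1) =
      ∑ i ∈ range n, volume (A ∩ Set.Icc ((i : ℝ) / n) (((i + 1 : ℕ) : ℝ) / n)) := by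
  have hn' : (n : ℝ) ≠ 0 := by exact_mod_cast hn.ne'
  rw [← volume_inter_Icc_eq_sum A (t := fun i : ℕ => (i : ℝ) / n)
    (fun i j hij => by dsimp only; gcongr)]
  simp [div_self hn']

/-- On the `i`-th cell, the interpolation of `stepCDF n w ∘ w` has slope `± c`, where `c` is the
number of cells traversing the same level. -/
lemma volume_preimage_cell {n : ℕ} (hn : 0 < n) {w : ℕ → ℕ} {i : ℕ} (hi : i < n)
    (hstep : w (i + 1) = w i + 1 ∨ w i = w (i + 1) + 1) (A : Set ℝ) {k : ℕ}
    (hk : min (w i) (w (i + 1)) = k) :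
    volume (gridInterp n (stepCDF n w ∘ w) ⁻¹' A ∩
        Set.Icc ((i : ℝ) / n) (((i + 1 : ℕ) : ℝ) / n)) =
      (#{j ∈ range n | min (w j) (w (j + 1)) = k} : ENNReal)⁻¹ *
        volume (A ∩ Set.Icc (stepCDF n w k) (stepCDF n w (k + 1))) := by
  have hn' : (0 : ℝ) < n := by exact_mod_cast hn
  set S := stepCDF n w with hS
  set c := #{j ∈ range n | min (w j) (w (j + 1)) = k} with hc
  have hcpos : 0 < c := card_pos.2 ⟨i, mem_filter.2 ⟨mem_range.2 hi, hk⟩⟩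
  have hc' : (0 : ℝ) < c := by exact_mod_cast hcpos
  have hSk : S (k + 1) = S k + c / n := stepCDF_succ n w k
  have hle : S k ≤ S (k + 1) := stepCDF_mono n w k.le_succ
  have hpq : (i : ℝ) / n ≤ ((i + 1 : ℕ) : ℝ) / n := by gcongr; omega
  set a := (S (w (i + 1)) - S (w i)) * n with ha
  have hset : gridInterp n (S ∘ w) ⁻¹' A ∩ Set.Icc ((i : ℝ) / n) (((i + 1 : ℕ) : ℝ) / n) =
      (fun x => a * x + (S (w i) - (S (w (i + 1)) - S (w i)) * i)) ⁻¹' A ∩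
        Set.Icc ((i : ℝ) / n) (((i + 1 : ℕ) : ℝ) / n) := by
    ext x
    refine and_congr_left fun hx => ?_
    rw [Set.mem_Icc, div_le_iff₀' hn', le_div_iff₀' hn'] at hx
    rw [Set.mem_preimage, Set.mem_preimage, gridInterp_eq _ hi hx.1 (by exact_mod_cast hx.2)]
    simp only [Function.comp_apply, ha]
    ring_nf
  have hp : a * ((i : ℝ) / n) + (S (w i) - (S (w (i + 1)) - S (w i)) * i) = S (w i) := by
    rw [ha]; field_simp; ring
  have hq : a * (((i + 1 : ℕ) : ℝ) / n) + (S (w i) - (S (w (i + 1)) - S (w i)) * i) =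
      S (w (i + 1)) := by
    rw [ha]; push_cast; field_simp; ring
  have habs : |a| = c ∧ Set.uIcc (S (w i)) (S (w (i + 1))) = Set.Icc (S k) (S (k + 1)) := by
    rcases hstep with h | h
    · obtain rfl : k = w i := by omega
      refine ⟨?_, by rw [h, Set.uIcc_of_le hle]⟩
      rw [ha, h, hSk, add_sub_cancel_left, div_mul_cancel₀ _ hn'.ne', abs_of_pos hc']
    · obtain rfl : k = w (i + 1) := by omega
      refine ⟨?_, by rw [h, Set.uIcc_of_ge hle]⟩
      rw [ha, h, hSk, sub_add_cancel_left, neg_mul, div_mul_cancel₀ _ hn'.ne', abs_neg,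
        abs_of_pos hc']
  have ha0 : a ≠ 0 := abs_pos.1 (habs.1 ▸ hc')
  rw [hset, volume_affine_preimage_inter_Icc A ha0 _ _ _ hpq, hp, hq, habs.2, abs_inv, habs.1,
    ENNReal.ofReal_inv_of_pos hc', ENNReal.ofReal_natCast]

lemma map_gridInterp_stepCDF {n M : ℕ} (hn : 0 < n) {w : ℕ → ℕ}
    (hstep : ∀ i < n, w (i + 1) = w i + 1 ∨ w i = w (i + 1) + 1) (hwM : ∀ i ≤ n, w i ≤ M) :
    unif.map (gridInterp n (stepCDF n w ∘ w)) = unif := by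
  have hlow : ∀ i < n, min (w i) (w (i + 1)) < M := fun i hi =>
    min_lt_of_step (hstep i hi) (hwM i hi.le) (hwM (i + 1) hi)
  ext A hA
  rw [Measure.map_apply (continuous_gridInterp _ _).measurable hA, unif,
    Measure.restrict_apply' measurableSet_Icc, Measure.restrict_apply' measurableSet_Icc,
    volume_inter_Icc_grid _ hn,
    ← sum_fiberwise_of_maps_to (t := range M) (g := fun i => min (w i) (w (i + 1)))
      (fun i hi => mem_range.2 (hlow i (mem_range.1 hi))),
    ← stepCDF_zero n w, ← stepCDF_eq_one hn hlow,
    volume_inter_Icc_eq_sum A (stepCDF_mono n w)]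
  refine sum_congr rfl fun k _ => ?_
  rw [sum_congr rfl fun i hi => volume_preimage_cell hn (mem_range.1 (mem_filter.1 hi).1)
    (hstep i (mem_range.1 (mem_filter.1 hi).1)) A (mem_filter.1 hi).2, sum_const, nsmul_eq_mul,
    ← mul_assoc]
  rcases Nat.eq_zero_or_pos #{i ∈ range n | min (w i) (w (i + 1)) = k} with h | h
  · rw [stepCDF_succ, h]
    simp only [Nat.cast_zero, zero_mul, zero_div, add_zero, Set.Icc_self]
    exact (measure_mono_null Set.inter_subset_right (by simp)).symm
  · rw [ENNReal.mul_inv_cancel (by exact_mod_cast h.ne') (ENNReal.natCast_ne_top _), one_mul]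

lemma sum_volume_cells {n : ℕ} (hn : 0 < n) (s : Finset ℕ) :
    ∑ i ∈ s, volume (Set.Icc ((i : ℝ) / n) (((i + 1 : ℕ) : ℝ) / n)) =
      ENNReal.ofReal ((#s : ℝ) / n) := by
  have hn' : (0 : ℝ) < n := by exact_mod_cast hn
  have h : ∀ i : ℕ, volume (Set.Icc ((i : ℝ) / n) (((i + 1 : ℕ) : ℝ) / n)) =
      ENNReal.ofReal (1 / n) := fun i => by
    rw [Real.volume_Icc]
    congr 1
    push_cast
    ring
  simp only [h, sum_const]
  rw [← ENNReal.ofReal_nsmul, nsmul_eq_mul, mul_one_div]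

/-- If the walk `w` follows `M * f` up to an error of `2`, then `stepCDF n w` is close to the
distribution function of `f`. -/
lemma abs_stepCDF_sub_le {f : ℝ → ℝ} (hf : ContinuousOn f (Set.Icc 0 1))
    (hpres : unif.map f = unif) {n M : ℕ} (hn : 0 < n) (hM : 0 < M) {w : ℕ → ℕ}
    (hstep : ∀ i < n, w (i + 1) = w i + 1 ∨ w i = w (i + 1) + 1)
    (hnear : ∀ i < n, ∀ x ∈ Set.Icc ((i : ℝ) / n) (((i + 1 : ℕ) : ℝ) / n),
      |f x - w i / M| ≤ 2 / M ∧ |f x - w (i + 1) / M| ≤ 2 / M) {k : ℕ} (hk : k ≤ M) :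
    |stepCDF n w k - k / M| ≤ 2 / M := by
  have hM' : (0 : ℝ) < M := by exact_mod_cast hM
  have hk' : (k : ℝ) ≤ M := by exact_mod_cast hk
  have hf' : AEMeasurable f unif := hf.aemeasurable measurableSet_Icc
  have hpre : ∀ {B : Set ℝ}, MeasurableSet B →
      volume (f ⁻¹' B ∩ Set.Icc 0 1) = volume (B ∩ Set.Icc 0 1) := fun {B} hB => by
    rw [← Measure.restrict_apply' measurableSet_Icc, ← Measure.restrict_apply' measurableSet_Icc,
      ← unif, ← Measure.map_apply_of_aemeasurable hf' hB, hpres]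
  have hupper : stepCDF n w k ≤ (k + 2) / M := by
    rw [← ENNReal.ofReal_le_ofReal_iff (by positivity)]
    calc ENNReal.ofReal (stepCDF n w k)
        = ∑ i ∈ range n with min (w i) (w (i + 1)) < k,
            volume (Set.Icc ((i : ℝ) / n) (((i + 1 : ℕ) : ℝ) / n)) :=
          (sum_volume_cells hn _).symm
      _ = ∑ i ∈ range n with min (w i) (w (i + 1)) < k,
            volume (f ⁻¹' Set.Iic ((k + 2 : ℝ) / M) ∩
              Set.Icc ((i : ℝ) / n) (((i + 1 : ℕ) : ℝ) / n)) := by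
          refine sum_congr rfl fun i hi => ?_
          obtain ⟨hi, hlt⟩ := mem_filter.1 hi
          have hi := mem_range.1 hi
          rw [Set.inter_eq_self_of_subset_right]
          intro x hx
          have hwk : w i ≤ k := by have := hstep i hi; omega
          have hwk' : (w i : ℝ) / M ≤ k / M := by gcongr
          have := (abs_le.1 (hnear i hi x hx).1).2
          rw [Set.mem_preimage, Set.mem_Iic, add_div]
          linarith
      _ ≤ ∑ i ∈ range n, volume (f ⁻¹' Set.Iic ((k + 2 : ℝ) / M) ∩
              Set.Icc ((i : ℝ) / n) (((i + 1 : ℕ) : ℝ) / n)) :=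
          sum_le_sum_of_subset (filter_subset _ _)
      _ = volume (Set.Iic ((k + 2 : ℝ) / M) ∩ Set.Icc 0 1) := by
          rw [← volume_inter_Icc_grid _ hn, hpre measurableSet_Iic]
      _ ≤ volume (Set.Icc 0 ((k + 2 : ℝ) / M)) :=
          measure_mono fun x hx => ⟨hx.2.1, hx.1⟩
      _ = ENNReal.ofReal ((k + 2) / M) := by rw [Real.volume_Icc, sub_zero]
  have hlower : ((k : ℝ) - 2) / M ≤ stepCDF n w k := by
    have hS0 : 0 ≤ stepCDF n w k := by unfold stepCDF; positivity
    rw [← ENNReal.ofReal_le_ofReal_iff hS0]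
    calc ENNReal.ofReal (((k : ℝ) - 2) / M)
        = volume (Set.Ico 0 (((k : ℝ) - 2) / M)) := by rw [Real.volume_Ico, sub_zero]
      _ ≤ volume (Set.Iio (((k : ℝ) - 2) / M) ∩ Set.Icc 0 1) := by
          refine measure_mono fun x hx => ⟨hx.2, hx.1, hx.2.le.trans ?_⟩
          rw [div_le_one hM']
          linarith
      _ = ∑ i ∈ range n, volume (f ⁻¹' Set.Iio (((k : ℝ) - 2) / M) ∩
              Set.Icc ((i : ℝ) / n) (((i + 1 : ℕ) : ℝ) / n)) := by
          rw [← volume_inter_Icc_grid _ hn, hpre measurableSet_Iio]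
      _ = ∑ i ∈ range n with min (w i) (w (i + 1)) < k,
            volume (f ⁻¹' Set.Iio (((k : ℝ) - 2) / M) ∩
              Set.Icc ((i : ℝ) / n) (((i + 1 : ℕ) : ℝ) / n)) := by
          refine (sum_filter_of_ne fun i hi hne => ?_).symm
          have hi := mem_range.1 hi
          obtain ⟨x, hx, hxi⟩ := nonempty_of_measure_ne_zero hne
          rw [Set.mem_preimage, Set.mem_Iio, sub_div] at hx
          have := (abs_le.1 (hnear i hi x hxi).1).1
          have hwk : (w i : ℝ) / M < k / M := by linarith
          rw [div_lt_div_iff_of_pos_right hM', Nat.cast_lt] at hwk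
          exact (min_le_left _ _).trans_lt hwk
      _ ≤ ∑ i ∈ range n with min (w i) (w (i + 1)) < k,
            volume (Set.Icc ((i : ℝ) / n) (((i + 1 : ℕ) : ℝ) / n)) :=
          sum_le_sum fun i _ => measure_mono Set.inter_subset_right
      _ = ENNReal.ofReal (stepCDF n w k) := sum_volume_cells hn _
  rw [add_div] at hupper
  rw [sub_div] at hlower
  exact abs_le.2 ⟨by linarith, by linarith⟩

/-- A continuous self-map of `[0,1]` is followed on a fine grid by a walk of step size `1 / M`. -/
lemma exists_walk_near {f : ℝ → ℝ} (hf : ContinuousOn f (Set.Icc 0 1))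
    (hmaps : Set.MapsTo f (Set.Icc 0 1) (Set.Icc 0 1)) {M : ℕ} (hM : 0 < M) :
    ∃ (n : ℕ) (w : ℕ → ℕ), 0 < n ∧ (∀ i ≤ n, w i ≤ M) ∧
      (∀ i < n, w (i + 1) = w i + 1 ∨ w i = w (i + 1) + 1) ∧
      ∀ i < n, ∀ x ∈ Set.Icc ((i : ℝ) / n) (((i + 1 : ℕ) : ℝ) / n),
        |f x - w i / M| ≤ 2 / M ∧ |f x - w (i + 1) / M| ≤ 2 / M := by
  have hM' : (0 : ℝ) < M := by exact_mod_cast hM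
  obtain ⟨δ, hδ, hδf⟩ := Metric.uniformContinuousOn_iff.1
    (isCompact_Icc.uniformContinuousOn_of_continuous hf) (1 / M) (by positivity)
  obtain ⟨m, hm⟩ := exists_nat_one_div_lt hδ
  set n := m + 1 with hn
  have hn' : (0 : ℝ) < n := by positivity
  have hnδ : 1 / (n : ℝ) < δ := by rw [hn]; exact_mod_cast hm
  have hgrid : ∀ i ≤ n, (i : ℝ) / n ∈ Set.Icc (0 : ℝ) 1 := fun i hi =>
    ⟨by positivity, (div_le_one hn').2 (by exact_mod_cast hi)⟩
  have hex : ∀ i, ∃ w : ℕ, i ≤ n → w ≤ M ∧ w % 2 = i % 2 ∧ |(w : ℝ) - M * f (i / n)| ≤ 1 := by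
    intro i
    by_cases hi : i ≤ n
    · have h := hmaps (hgrid i hi)
      obtain ⟨w, hw⟩ := exists_nat_near_of_parity hM (mul_nonneg hM'.le h.1)
        (mul_le_of_le_one_right hM'.le h.2) i
      exact ⟨w, fun _ => hw⟩
    · exact ⟨0, fun h => absurd h hi⟩
  choose w hw using hex
  have hclose : ∀ i < n, ∀ x ∈ Set.Icc ((i : ℝ) / n) (((i + 1 : ℕ) : ℝ) / n),
      |M * f x - M * f (i / n)| < 1 ∧ |M * f x - M * f (((i + 1 : ℕ) : ℝ) / n)| < 1 := by
    intro i hi x hx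
    have hcell : ((i + 1 : ℕ) : ℝ) / n = i / n + 1 / n := by push_cast; ring
    have h0 := hgrid i hi.le
    have h1 := hgrid (i + 1) hi
    have hx01 : x ∈ Set.Icc (0 : ℝ) 1 := ⟨h0.1.trans hx.1, hx.2.trans h1.2⟩
    have key : ∀ y ∈ Set.Icc (0 : ℝ) 1, |x - y| < δ → |M * f x - M * f y| < 1 := by
      intro y hy hxy
      have := hδf x hx01 y hy hxy
      rwa [Real.dist_eq, lt_div_iff₀' hM', ← abs_of_pos hM', ← abs_mul,
        mul_sub] at this
    have hx1 := hx.1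
    have hx2 := hx.2
    exact ⟨key _ h0 (abs_lt.2 ⟨by linarith, by linarith⟩),
      key _ h1 (abs_lt.2 ⟨by linarith, by linarith⟩)⟩
  refine ⟨n, w, m.succ_pos, fun i hi => (hw i hi).1, fun i hi => ?_, fun i hi x hx => ?_⟩
  · obtain ⟨-, hp, hn1⟩ := hw i hi.le
    obtain ⟨-, hp', hn2⟩ := hw (i + 1) hi
    have h := (hclose i hi (i / n) ⟨le_rfl, by gcongr; omega⟩).2
    rw [abs_le] at hn1 hn2
    rw [abs_lt] at h
    have h1 : (w (i + 1) : ℝ) < w i + 3 := by linarith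
    have h2 : (w i : ℝ) < w (i + 1) + 3 := by linarith
    have h1' : w (i + 1) < w i + 3 := by exact_mod_cast h1
    have h2' : w i < w (i + 1) + 3 := by exact_mod_cast h2
    omega
  · have h := hclose i hi x hx
    have scale : ∀ u y : ℝ, |u - M * y| ≤ 1 → |M * f x - M * y| < 1 →
        |f x - u / M| ≤ 2 / M := by
      intro u y hu hxy
      rw [le_div_iff₀' hM', ← abs_of_pos hM', ← abs_mul, abs_of_pos hM', mul_sub,
        mul_div_cancel₀ _ hM'.ne']
      rw [abs_le] at hu ⊢
      rw [abs_lt] at hxy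
      exact ⟨by linarith, by linarith⟩
    exact ⟨scale _ _ (hw i hi.le).2.2 h.1, scale _ _ (hw (i + 1) hi).2.2 h.2⟩

/-- **Tichy–Winkler density theorem.** The continuous piecewise linear Lebesgue-measure-
preserving maps of `[0,1]` are dense, for the supremum norm, in the set of all continuous
Lebesgue-measure-preserving maps of `[0,1]`. -/
theorem stmt_4 (f : ℝ → ℝ) (hf : ContinuousOn f (Set.Icc 0 1))
    (hmaps : Set.MapsTo f (Set.Icc 0 1) (Set.Icc 0 1))
    (hpres : unif.map f = unif) (ε : ℝ) (hε : 0 < ε) :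
    ∃ g : ℝ → ℝ, ContinuousOn g (Set.Icc 0 1) ∧
      Set.MapsTo g (Set.Icc 0 1) (Set.Icc 0 1) ∧
      unif.map g = unif ∧ IsPiecewiseLinear g ∧
      ∀ x ∈ Set.Icc (0:ℝ) 1, |f x - g x| < ε := by
  obtain ⟨M, hMε⟩ := exists_nat_gt (4 / ε)
  have hM' : (0 : ℝ) < M := lt_trans (by positivity) hMε
  have hM : 0 < M := by exact_mod_cast hM'
  obtain ⟨n, w, hn, hwM, hstep, hnear⟩ := exists_walk_near hf hmaps hM
  have hn' : (0 : ℝ) < n := by exact_mod_cast hn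
  have hS : ∀ k ≤ M, |stepCDF n w k - k / M| ≤ 2 / M := fun k hk =>
    abs_stepCDF_sub_le hf hpres hn hM hstep hnear hk
  have hS1 : stepCDF n w M = 1 := stepCDF_eq_one hn fun i hi =>
    min_lt_of_step (hstep i hi) (hwM i hi.le) (hwM (i + 1) hi)
  have hS01 : ∀ k ≤ M, stepCDF n w k ∈ Set.Icc (0 : ℝ) 1 := fun k hk =>
    ⟨stepCDF_zero n w ▸ stepCDF_mono n w (Nat.zero_le k), hS1 ▸ stepCDF_mono n w hk⟩
  have hconv : ∀ x ∈ Set.Icc (0 : ℝ) 1, ∀ s : Set ℝ, Convex ℝ s →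
      (∀ i < n, x ∈ Set.Icc ((i : ℝ) / n) (((i + 1 : ℕ) : ℝ) / n) →
        stepCDF n w (w i) ∈ s ∧ stepCDF n w (w (i + 1)) ∈ s) →
      gridInterp n (stepCDF n w ∘ w) x ∈ s := by
    intro x hx s hs h
    obtain ⟨i, hi, h0, h1⟩ := exists_grid_cell hn hx
    obtain ⟨hu, hv⟩ := h i hi
      ⟨(div_le_iff₀' hn').2 h0, (le_div_iff₀' hn').2 (by push_cast; exact h1)⟩
    rw [gridInterp_eq _ hi h0 h1]
    convert hs.add_smul_sub_mem hu hv (t := n * x - i) ⟨by linarith, by linarith⟩ using 1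
    simp [mul_comm]
  refine ⟨gridInterp n (stepCDF n w ∘ w), (continuous_gridInterp _ _).continuousOn,
    fun x hx => ?_, map_gridInterp_stepCDF hn hstep hwM, isPiecewiseLinear_gridInterp hn _,
    fun x hx => ?_⟩
  · exact hconv x hx _ (convex_Icc 0 1) fun i hi _ =>
      ⟨hS01 _ (hwM i hi.le), hS01 _ (hwM (i + 1) hi)⟩
  · have hball : gridInterp n (stepCDF n w ∘ w) x ∈ Metric.closedBall (f x) (4 / M) := by
      refine hconv x hx _ (convex_closedBall _ _) fun i hi hxi => ?_
      have key : ∀ k ≤ M, |f x - k / M| ≤ 2 / M →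
          stepCDF n w k ∈ Metric.closedBall (f x) (4 / M) := by
        intro k hk h
        have h4 : (4 : ℝ) / M = 2 / M + 2 / M := by ring
        rw [Metric.mem_closedBall, Real.dist_eq, h4]
        rw [abs_sub_comm] at h
        exact (abs_sub_le _ _ _).trans (add_le_add (hS k hk) h)
      exact ⟨key _ (hwM i hi.le) (hnear i hi x hxi).1, key _ (hwM (i + 1) hi) (hnear i hi x hxi).2⟩
    rw [Metric.mem_closedBall, dist_comm, Real.dist_eq] at hball
    exact hball.trans_lt ((div_lt_comm₀ hε hM').1 hMε)
end

section
/- Let c : [0,1]² → ℝ be continuous on [0,1]², twice continuously differentiable on (0,1)², with ∂²c/∂x∂y(x,y) > 0 for all (x,y) ∈ (0,1)². Then the maximum of ∫_{[0,1]²} c dγ over all copula measures γ equals ∫₀¹ c(x,x) dx, and it is attained by the comonotone copula measure, i.e., the pushforward of the Lebesgue measure on [0,1] under the map x ↦ (x,x). -/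
open MeasureTheory

/-- The mixed second partial derivative `∂²c/∂x∂y` of `c : ℝ × ℝ → ℝ` at `p`. -/
noncomputable def mixedPartial (c : ℝ × ℝ → ℝ) (p : ℝ × ℝ) : ℝ :=
  deriv (fun x => deriv (fun y => c (x, y)) p.2) p.1

open Filter Topology Set

/-- The potential built from the forward differences of `a` along the diagonal. -/
noncomputable def diagPotential (a : ℕ → ℕ → ℝ) (i : ℕ) : ℝ :=
  ∑ k ∈ Finset.range i, (a (k + 1) k - a k k)

lemma le_diagPotential_add (n : ℕ) (a : ℕ → ℕ → ℝ)
    (ha : ∀ i i' j j', i ≤ i' → i' ≤ n → j ≤ j' → j' ≤ n →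
      a i' j + a i j' ≤ a i j + a i' j') {i j : ℕ} (hi : i ≤ n) (hj : j ≤ n) :
    a i j ≤ diagPotential a i + (a j j - diagPotential a j) := by
  rcases le_total j i with h | h
  · induction i, h using Nat.le_induction with
    | base => linarith
    | succ m hm ih =>
      have h1 := ih (by omega)
      have h2 := ha m (m + 1) j m (by omega) hi hm (by omega)
      have h3 : diagPotential a (m + 1) = diagPotential a m + (a (m + 1) m - a m m) :=
        Finset.sum_range_succ _ _
      linarith
  · induction h using Nat.decreasingInduction with
    | self => linarith
    | of_succ m hm ih =>
      have h1 := ih (by omega)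
      have h2 := ha m (m + 1) m j (by omega) (by omega) (by omega) hj
      have h3 : diagPotential a (m + 1) = diagPotential a m + (a (m + 1) m - a m m) :=
        Finset.sum_range_succ _ _
      linarith

lemma supermodular_of_mixedPartial_pos {c : ℝ × ℝ → ℝ}
    (hc : ContinuousOn c (Icc 0 1 ×ˢ Icc 0 1))
    (hC : DifferentiableOn ℝ c (Ioo 0 1 ×ˢ Ioo 0 1))
    (hmix : ∀ p ∈ Ioo (0:ℝ) 1 ×ˢ Ioo (0:ℝ) 1, 0 < mixedPartial c p)
    {x x' y y' : ℝ} (hx : x ∈ Icc (0:ℝ) 1) (hx' : x' ∈ Icc (0:ℝ) 1) (hxx : x ≤ x')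
    (hy : y ∈ Icc (0:ℝ) 1) (hy' : y' ∈ Icc (0:ℝ) 1) (hyy : y ≤ y') :
    c (x', y) + c (x, y') ≤ c (x, y) + c (x', y') := by
  have hcy : ∀ y ∈ Icc (0:ℝ) 1, ContinuousOn (fun x => c (x, y)) (Icc 0 1) := fun y hy =>
    hc.comp (by fun_prop) fun x hx => ⟨hx, hy⟩
  have hcx : ∀ x ∈ Icc (0:ℝ) 1, ContinuousOn (fun y => c (x, y)) (Icc 0 1) := fun x hx =>
    hc.comp (by fun_prop) fun y hy => ⟨hx, hy⟩
  have hdy : ∀ x ∈ Ioo (0:ℝ) 1, ∀ y ∈ Ioo (0:ℝ) 1,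
      DifferentiableAt ℝ (fun y => c (x, y)) y := fun x hx y hy =>
    DifferentiableAt.comp (f := fun y => (x, y)) y
      (hC.differentiableAt ((isOpen_Ioo.prod isOpen_Ioo).mem_nhds ⟨hx, hy⟩)) (by fun_prop)
  have hmono : ∀ y ∈ Ioo (0:ℝ) 1,
      StrictMonoOn (fun x => deriv (fun y => c (x, y)) y) (Ioo 0 1) := by
    intro y hy
    refine strictMonoOn_of_deriv_pos (convex_Ioo 0 1) (fun x hx => ?_) fun x hx => ?_
    · exact (differentiableAt_of_deriv_ne_zero
        (hmix (x, y) ⟨hx, hy⟩).ne').continuousAt.continuousWithinAt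
    · rw [interior_Ioo] at hx
      exact hmix (x, y) ⟨hx, hy⟩
  have hopen : MonotoneOn (fun x => c (x, y') - c (x, y)) (Ioo 0 1) := by
    intro x hx x' hx' hxx
    have key : MonotoneOn (fun y => c (x', y) - c (x, y)) (Icc 0 1) := by
      refine monotoneOn_of_deriv_nonneg (convex_Icc 0 1)
        ((hcx x' (Ioo_subset_Icc_self hx')).sub (hcx x (Ioo_subset_Icc_self hx)))
        (fun y hy => ?_) fun y hy => ?_
      · rw [interior_Icc] at hy
        exact ((hdy x' hx' y hy).sub (hdy x hx y hy)).differentiableWithinAt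
      · rw [interior_Icc] at hy
        rw [deriv_fun_sub (hdy x' hx' y hy) (hdy x hx y hy), sub_nonneg]
        exact (hmono y hy).monotoneOn hx hx' hxx
    have := key hy hy' hyy
    simp only at this ⊢
    linarith
  have hclosed : MonotoneOn (fun x => c (x, y') - c (x, y)) (Icc 0 1) := by
    have hmem : ∀ x ∈ Icc (0:ℝ) 1, ∀ t ∈ Ioo (0:ℝ) 1, (1 - t) * x + t / 2 ∈ Ioo (0:ℝ) 1 :=
      fun x hx t ht => ⟨by nlinarith [hx.1, ht.1, ht.2], by nlinarith [hx.2, ht.1, ht.2]⟩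
    have hcont : ∀ x ∈ Icc (0:ℝ) 1, ContinuousWithinAt
        (fun t : ℝ => c ((1 - t) * x + t / 2, y') - c ((1 - t) * x + t / 2, y))
        (Ioo 0 1) 0 := by
      intro x hx
      refine ContinuousWithinAt.comp (f := fun t : ℝ => (1 - t) * x + t / 2)
        (g := fun x => c (x, y') - c (x, y)) (t := Icc 0 1) ?_
        (by fun_prop) fun t ht => Ioo_subset_Icc_self (hmem x hx t ht)
      simpa using ((hcy y' hy').fun_sub (hcy y hy)) x hx
    intro x hx x' hx' hxx
    have h0 : (0:ℝ) ∈ closure (Ioo (0:ℝ) 1) := by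
      rw [closure_Ioo zero_ne_one]
      exact left_mem_Icc.2 zero_le_one
    have := ContinuousWithinAt.closure_le h0 (hcont x hx) (hcont x' hx') fun t ht =>
      hopen (hmem x hx t ht) (hmem x' hx' t ht) (by nlinarith [ht.2])
    simpa using this
  have := hclosed hx hx' hxx
  simp only at this
  linarith

lemma isProbabilityMeasure_unif : IsProbabilityMeasure unif :=
  ⟨by simp [unif]⟩

lemma ae_unif_mem_Icc : ∀ᵐ x ∂unif, x ∈ Icc (0:ℝ) 1 :=
  ae_restrict_mem measurableSet_Icc

lemma isCopula_comonotone : IsCopula (unif.map fun x => (x, x)) := by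
  have := isProbabilityMeasure_unif
  refine ⟨Measure.isProbabilityMeasure_map (by fun_prop), ?_, ?_⟩
  · rw [Measure.map_map (by fun_prop) (by fun_prop)]
    exact Measure.map_id
  · rw [Measure.map_map (by fun_prop) (by fun_prop)]
    exact Measure.map_id

lemma IsCopula.ae_mem {γ : Measure (ℝ × ℝ)} (hγ : IsCopula γ) :
    ∀ᵐ p ∂γ, p ∈ Icc (0:ℝ) 1 ×ˢ Icc (0:ℝ) 1 := by
  have h1 : ∀ᵐ p ∂γ, p.1 ∈ Icc (0:ℝ) 1 :=
    ae_of_ae_map (by fun_prop) (hγ.2.1 ▸ ae_unif_mem_Icc)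
  have h2 : ∀ᵐ p ∂γ, p.2 ∈ Icc (0:ℝ) 1 :=
    ae_of_ae_map (by fun_prop) (hγ.2.2 ▸ ae_unif_mem_Icc)
  filter_upwards [h1, h2] with p h1 h2 using ⟨h1, h2⟩

lemma natFloor_mul_le {x : ℝ} (hx : x ∈ Icc (0:ℝ) 1) (n : ℕ) : ⌊x * n⌋₊ ≤ n :=
  Nat.floor_le_of_le (mul_le_of_le_one_left n.cast_nonneg hx.2)

lemma natCast_div_mem_Icc {i n : ℕ} (h : i ≤ n) : (i / n : ℝ) ∈ Icc (0:ℝ) 1 :=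
  ⟨by positivity, div_le_one_of_le₀ (by exact_mod_cast h) n.cast_nonneg⟩

lemma tendsto_integral_grid {c : ℝ × ℝ → ℝ} (hc : ContinuousOn c (Icc 0 1 ×ˢ Icc 0 1))
    {γ : Measure (ℝ × ℝ)} (hγ : IsCopula γ) :
    Tendsto (fun n : ℕ => ∫ p, c (⌊p.1 * n⌋₊ / n, ⌊p.2 * n⌋₊ / n) ∂γ) atTop
      (𝓝 (∫ p, c p ∂γ)) := by
  have := hγ.1
  obtain ⟨C, hC⟩ := (isCompact_Icc.prod isCompact_Icc).exists_bound_of_continuousOn hc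
  refine tendsto_integral_of_dominated_convergence (fun _ => C) (fun n => ?_)
    (integrable_const C) (fun n => ?_) ?_
  · have hG : Measurable fun q : ℕ × ℕ => c (q.1 / n, q.2 / n) := Measurable.of_discrete
    have hk : Measurable fun p : ℝ × ℝ => (⌊p.1 * n⌋₊, ⌊p.2 * n⌋₊) := by fun_prop
    exact (hG.comp hk).aestronglyMeasurable
  · filter_upwards [hγ.ae_mem] with p hp
    exact hC _ ⟨natCast_div_mem_Icc (natFloor_mul_le hp.1 n),
      natCast_div_mem_Icc (natFloor_mul_le hp.2 n)⟩
  · filter_upwards [hγ.ae_mem] with p hp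
    refine (hc p hp).tendsto.comp (tendsto_nhdsWithin_iff.2 ⟨?_, .of_forall fun n =>
      ⟨natCast_div_mem_Icc (natFloor_mul_le hp.1 n),
        natCast_div_mem_Icc (natFloor_mul_le hp.2 n)⟩⟩)
    exact ((tendsto_nat_floor_mul_div_atTop hp.1.1).comp tendsto_natCast_atTop_atTop).prodMk_nhds
      ((tendsto_nat_floor_mul_div_atTop hp.2.1).comp tendsto_natCast_atTop_atTop)

lemma integrable_comp_natFloor (f : ℕ → ℝ) (n : ℕ) :
    Integrable (fun x : ℝ => f ⌊x * n⌋₊) unif := by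
  have := isProbabilityMeasure_unif
  have hf : Measurable f := Measurable.of_discrete
  refine Integrable.of_bound (C := ∑ i ∈ Finset.range (n + 1), |f i|)
    (hf.comp (by fun_prop : Measurable fun x : ℝ => ⌊x * n⌋₊)).aestronglyMeasurable ?_
  filter_upwards [ae_unif_mem_Icc] with x hx
  exact Finset.single_le_sum (f := fun i => |f i|) (fun i _ => abs_nonneg _)
    (Finset.mem_range.2 (Nat.lt_succ_of_le (natFloor_mul_le hx n)))

lemma IsCopula.integral_grid_le {c : ℝ × ℝ → ℝ} {γ : Measure (ℝ × ℝ)} (hγ : IsCopula γ)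
    (hsm : ∀ x x' y y' : ℝ, x ∈ Icc (0:ℝ) 1 → x' ∈ Icc (0:ℝ) 1 → x ≤ x' →
      y ∈ Icc (0:ℝ) 1 → y' ∈ Icc (0:ℝ) 1 → y ≤ y' →
      c (x', y) + c (x, y') ≤ c (x, y) + c (x', y')) (n : ℕ) :
    ∫ p, c (⌊p.1 * n⌋₊ / n, ⌊p.2 * n⌋₊ / n) ∂γ ≤
      ∫ x, c (⌊x * n⌋₊ / n, ⌊x * n⌋₊ / n) ∂unif := by
  have := hγ.1
  set a : ℕ → ℕ → ℝ := fun i j => c (i / n, j / n)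
  have ha_sm : ∀ i i' j j', i ≤ i' → i' ≤ n → j ≤ j' → j' ≤ n →
      a i' j + a i j' ≤ a i j + a i' j' := fun i i' j j' hi hi' hj hj' =>
    hsm _ _ _ _ (natCast_div_mem_Icc (hi.trans hi')) (natCast_div_mem_Icc hi') (by gcongr)
      (natCast_div_mem_Icc (hj.trans hj')) (natCast_div_mem_Icc hj') (by gcongr)
  set φ := diagPotential a
  have hφ := integrable_comp_natFloor φ n
  have hψ := integrable_comp_natFloor (fun j => a j j - φ j) n
  have hφγ : Integrable (fun p : ℝ × ℝ => φ ⌊p.1 * n⌋₊) γ :=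
    Integrable.comp_measurable (f := Prod.fst) (g := fun x : ℝ => φ ⌊x * n⌋₊)
      (by rwa [hγ.2.1]) measurable_fst
  have hψγ : Integrable (fun p : ℝ × ℝ => a ⌊p.2 * n⌋₊ ⌊p.2 * n⌋₊ - φ ⌊p.2 * n⌋₊) γ :=
    Integrable.comp_measurable (f := Prod.snd)
      (g := fun y : ℝ => a ⌊y * n⌋₊ ⌊y * n⌋₊ - φ ⌊y * n⌋₊) (by rwa [hγ.2.2]) measurable_snd
  have e1 : ∫ p, φ ⌊p.1 * n⌋₊ ∂γ = ∫ x, φ ⌊x * n⌋₊ ∂unif := by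
    have hm := hφ.aestronglyMeasurable
    rw [← hγ.2.1] at hm ⊢
    exact (integral_map (by fun_prop) hm).symm
  have e2 : ∫ p, (a ⌊p.2 * n⌋₊ ⌊p.2 * n⌋₊ - φ ⌊p.2 * n⌋₊) ∂γ
      = ∫ x, (a ⌊x * n⌋₊ ⌊x * n⌋₊ - φ ⌊x * n⌋₊) ∂unif := by
    have hm := hψ.aestronglyMeasurable
    rw [← hγ.2.2] at hm ⊢
    exact (integral_map (by fun_prop) hm).symm
  have hG : Measurable fun q : ℕ × ℕ => a q.1 q.2 := Measurable.of_discrete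
  have hint : Integrable (fun p : ℝ × ℝ => a ⌊p.1 * n⌋₊ ⌊p.2 * n⌋₊) γ := by
    refine Integrable.of_bound
      (C := ∑ q ∈ Finset.range (n + 1) ×ˢ Finset.range (n + 1), |a q.1 q.2|)
      (hG.comp (by fun_prop :
        Measurable fun p : ℝ × ℝ => (⌊p.1 * n⌋₊, ⌊p.2 * n⌋₊))).aestronglyMeasurable ?_
    filter_upwards [hγ.ae_mem] with p hp
    exact Finset.single_le_sum (f := fun q : ℕ × ℕ => |a q.1 q.2|) (fun i _ => abs_nonneg _)
      (a := (⌊p.1 * n⌋₊, ⌊p.2 * n⌋₊))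
      (Finset.mem_product.2
        ⟨Finset.mem_range.2 (Nat.lt_succ_of_le (natFloor_mul_le hp.1 n)),
          Finset.mem_range.2 (Nat.lt_succ_of_le (natFloor_mul_le hp.2 n))⟩)
  calc ∫ p, a ⌊p.1 * n⌋₊ ⌊p.2 * n⌋₊ ∂γ
      ≤ ∫ p, (φ ⌊p.1 * n⌋₊ + (a ⌊p.2 * n⌋₊ ⌊p.2 * n⌋₊ - φ ⌊p.2 * n⌋₊)) ∂γ := by
        refine integral_mono_ae hint (hφγ.add hψγ) ?_
        filter_upwards [hγ.ae_mem] with p hp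
        exact le_diagPotential_add n a ha_sm (natFloor_mul_le hp.1 n) (natFloor_mul_le hp.2 n)
    _ = ∫ x, φ ⌊x * n⌋₊ ∂unif + ∫ x, (a ⌊x * n⌋₊ ⌊x * n⌋₊ - φ ⌊x * n⌋₊) ∂unif := by
        rw [integral_add hφγ hψγ, e1, e2]
    _ = ∫ x, a ⌊x * n⌋₊ ⌊x * n⌋₊ ∂unif := by
        rw [← integral_add hφ hψ]
        exact integral_congr_ae (.of_forall fun x => by simp)

lemma IsCopula.aestronglyMeasurable {c : ℝ × ℝ → ℝ} {γ : Measure (ℝ × ℝ)} (hγ : IsCopula γ)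
    (hc : ContinuousOn c (Icc 0 1 ×ˢ Icc 0 1)) : AEStronglyMeasurable c γ := by
  rw [← Measure.restrict_eq_self_of_ae_mem hγ.ae_mem]
  exact hc.aestronglyMeasurable (measurableSet_Icc.prod measurableSet_Icc)

lemma integral_comonotone {c : ℝ × ℝ → ℝ}
    (hc : AEStronglyMeasurable c (unif.map fun x => (x, x))) :
    ∫ p, c p ∂(unif.map fun x => (x, x)) = ∫ x, c (x, x) ∂unif :=
  integral_map (by fun_prop) hc

/-- **Fialová–Strauch maximum theorem.** If `c : [0,1]² → ℝ` is continuous, twice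
continuously differentiable on `(0,1)²` with `∂²c/∂x∂y > 0` there, then the maximum of
`∫ c dγ` over all copula measures `γ` equals `∫₀¹ c (x,x) dx`, attained by the comonotone
copula measure, i.e. the pushforward of the uniform measure on `[0,1]` under `x ↦ (x,x)`. -/
theorem stmt_6 (c : ℝ × ℝ → ℝ)
    (hc : ContinuousOn c (Set.Icc 0 1 ×ˢ Set.Icc 0 1))
    (hC2 : ContDiffOn ℝ 2 c (Set.Ioo 0 1 ×ˢ Set.Ioo 0 1))
    (hmix : ∀ p ∈ Set.Ioo (0:ℝ) 1 ×ˢ Set.Ioo (0:ℝ) 1, 0 < mixedPartial c p) :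
    IsCopula (unif.map fun x => (x, x)) ∧
    (∫ p, c p ∂(unif.map fun x => (x, x))) = ∫ x in (0:ℝ)..1, c (x, x) ∧
    ∀ γ : Measure (ℝ × ℝ), IsCopula γ → ∫ p, c p ∂γ ≤ ∫ x in (0:ℝ)..1, c (x, x) := by
  have hm := isCopula_comonotone.aestronglyMeasurable hc
  have hint : ∫ x, c (x, x) ∂unif = ∫ x in (0:ℝ)..1, c (x, x) := by
    rw [intervalIntegral.integral_of_le zero_le_one, ← integral_Icc_eq_integral_Ioc, unif]
  have hdiag := (integral_comonotone hm).trans hint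
  refine ⟨isCopula_comonotone, hdiag, fun γ hγ => ?_⟩
  rw [← hdiag]
  refine le_of_tendsto_of_tendsto' (tendsto_integral_grid hc hγ)
    (tendsto_integral_grid hc isCopula_comonotone) fun n => ?_
  refine (hγ.integral_grid_le (fun x x' y y' hx hx' hxx hy hy' hyy =>
    supermodular_of_mixedPartial_pos hc (hC2.differentiableOn (by norm_num)) hmix
      hx hx' hxx hy hy' hyy) n).trans_eq ?_
  have hG : Measurable fun q : ℕ × ℕ => c (q.1 / n, q.2 / n) := Measurable.of_discrete
  exact (integral_comonotone (hG.comp (by fun_prop :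
    Measurable fun p : ℝ × ℝ => (⌊p.1 * n⌋₊, ⌊p.2 * n⌋₊))).aestronglyMeasurable).symm
end

section
/- Let X and Y be Polish spaces and c : X × Y → [0,∞) a finitely valued continuous cost function. Let μ_n → μ weakly on X and ν_n → ν weakly on Y, and for each n let π_n ∈ ADM(μ_n, ν_n) be an optimizer of the transport problem for (c, μ_n, ν_n). Assume the optimal values are finite. Then there is a subsequence (π_{n_k}) converging weakly to a transport plan π ∈ ADM(μ, ν) that optimizes the Monge–Kantorovich problem for (c, μ, ν); moreover every weak limit point of (π_n) is an optimizer for (c, μ, ν). -/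
open MeasureTheory Filter Topology

/-- Weak convergence of a sequence of measures: integrals of every bounded continuous
function converge. -/
def WeakTendsto {Z : Type*} [TopologicalSpace Z] [MeasurableSpace Z]
    (σ : ℕ → Measure Z) (ρ : Measure Z) : Prop :=
  ∀ g : BoundedContinuousFunction Z ℝ,
    Tendsto (fun n => ∫ z, g z ∂(σ n)) atTop (𝓝 (∫ z, g z ∂ρ))

/-- `γ` is a transport plan between `μ` and `ν`. -/
def IsCoupling {X Y : Type*} [MeasurableSpace X] [MeasurableSpace Y]
    (γ : Measure (X × Y)) (μ : Measure X) (ν : Measure Y) : Prop :=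
  IsProbabilityMeasure γ ∧ γ.map Prod.fst = μ ∧ γ.map Prod.snd = ν

open scoped ENNReal

/-- Cyclic exchange inequality for an optimal transport plan of finite cost: if `π` charges each
rectangle `U i ×ˢ V i`, then permuting the first factors cannot lower the total cost. -/
theorem sum_le_sum_of_isCoupling_of_optimal {X Y ι : Type*} [MeasurableSpace X]
    [MeasurableSpace Y] [Fintype ι] {C : X × Y → ℝ≥0∞}
    {π : Measure (X × Y)} {μ : Measure X} {ν : Measure Y} (hπ : IsCoupling π μ ν)
    (hopt : ∀ γ : Measure (X × Y), IsCoupling γ μ ν → ∫⁻ p, C p ∂π ≤ ∫⁻ p, C p ∂γ)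
    (hfin : ∫⁻ p, C p ∂π ≠ ∞) (σ : Equiv.Perm ι) {U : ι → Set X} {V : ι → Set Y}
    (hU : ∀ i, MeasurableSet (U i)) (hV : ∀ i, MeasurableSet (V i))
    (hpos : ∀ i, π (U i ×ˢ V i) ≠ 0) {a b : ι → ℝ≥0∞}
    (ha : ∀ i, ∀ x ∈ U i, ∀ y ∈ V i, a i ≤ C (x, y))
    (hb : ∀ i, ∀ x ∈ U (σ i), ∀ y ∈ V i, C (x, y) ≤ b i) :
    ∑ i, a i ≤ ∑ i, b i := by
  rcases isEmpty_or_nonempty ι with hι | hι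
  · simp
  obtain ⟨hprob, hfst, hsnd⟩ := hπ
  set B : ι → Set (X × Y) := fun i => U i ×ˢ V i with hB
  have hBm : ∀ i, MeasurableSet (B i) := fun i => (hU i).prod (hV i)
  set w : ι → Measure (X × Y) := fun i => ProbabilityTheory.cond π (B i) with hw
  have hwp : ∀ i, IsProbabilityMeasure (w i) := fun i =>
    ProbabilityTheory.cond_isProbabilityMeasure (hpos i)
  have hwB : ∀ i, ∀ᵐ p ∂(w i), p ∈ B i := fun i => ProbabilityTheory.ae_cond_mem (hBm i)
  set t : ℝ≥0∞ := ∑ i, (π (B i))⁻¹ with ht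
  have ht0 : t ≠ 0 := by
    obtain ⟨i⟩ := hι
    refine fun h => ?_
    have := (Finset.sum_eq_zero_iff.mp h) i (Finset.mem_univ i)
    exact measure_ne_top π _ (ENNReal.inv_eq_zero.mp this)
  have httop : t ≠ ∞ := by
    rw [ht, ENNReal.sum_ne_top]
    exact fun i _ => ENNReal.inv_ne_top.mpr (hpos i)
  have hm0 : t⁻¹ ≠ 0 := ENNReal.inv_ne_zero.mpr httop
  have hmtop : t⁻¹ ≠ ∞ := ENNReal.inv_ne_top.mpr ht0
  set κ : Measure (X × Y) := t⁻¹ • ∑ i, w i with hκ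
  have hκle : κ ≤ π := by
    rw [Measure.le_iff]
    intro s hs
    simp only [hκ, Measure.smul_apply, Measure.finsetSum_apply, smul_eq_mul]
    calc t⁻¹ * ∑ i, w i s ≤ t⁻¹ * ∑ i, (π (B i))⁻¹ * π s := by
          gcongr with i
          rw [hw, ProbabilityTheory.cond_apply (hBm i)]
          gcongr
          exact Set.inter_subset_right
      _ = π s := by
          rw [← Finset.sum_mul, ← mul_assoc, ENNReal.inv_mul_cancel ht0 httop, one_mul]
  have hκfin : IsFiniteMeasure κ := isFiniteMeasure_of_le π hκle
  set ρ : Measure (X × Y) := π - κ with hρ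
  have hρκ : ρ + κ = π := Measure.sub_add_cancel_of_le hκle
  set w' : ι → Measure (X × Y) := fun i =>
    ((w (σ i)).map Prod.fst).prod ((w i).map Prod.snd) with hw'
  have hw1 : ∀ i, IsProbabilityMeasure ((w i).map Prod.fst) := fun i =>
    Measure.isProbabilityMeasure_map measurable_fst.aemeasurable
  have hw2 : ∀ i, IsProbabilityMeasure ((w i).map Prod.snd) := fun i =>
    Measure.isProbabilityMeasure_map measurable_snd.aemeasurable
  set κ' : Measure (X × Y) := t⁻¹ • ∑ i, w' i with hκ'
  have hmap1 : κ'.map Prod.fst = κ.map Prod.fst := by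
    ext s hs
    rw [Measure.map_apply measurable_fst hs, Measure.map_apply measurable_fst hs]
    simp only [hκ, hκ', Measure.smul_apply, Measure.finsetSum_apply]
    congr 1
    rw [← Equiv.sum_comp σ (fun i => w i (Prod.fst ⁻¹' s))]
    refine Finset.sum_congr rfl fun i _ => ?_
    rw [← Measure.map_apply measurable_fst hs, hw', Measure.map_fst_prod]
    simp [Measure.map_apply measurable_fst hs]
  have hmap2 : κ'.map Prod.snd = κ.map Prod.snd := by
    ext s hs
    rw [Measure.map_apply measurable_snd hs, Measure.map_apply measurable_snd hs]
    simp only [hκ, hκ', Measure.smul_apply, Measure.finsetSum_apply]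
    congr 1
    refine Finset.sum_congr rfl fun i _ => ?_
    rw [← Measure.map_apply measurable_snd hs, hw', Measure.map_snd_prod]
    simp [Measure.map_apply measurable_snd hs]
  have hc1 : (ρ + κ').map Prod.fst = μ := by
    rw [Measure.map_add _ _ measurable_fst, hmap1, ← Measure.map_add _ _ measurable_fst, hρκ, hfst]
  have hc2 : (ρ + κ').map Prod.snd = ν := by
    rw [Measure.map_add _ _ measurable_snd, hmap2, ← Measure.map_add _ _ measurable_snd, hρκ, hsnd]
  have hcp : IsProbabilityMeasure (ρ + κ') := by
    have : IsProbabilityMeasure ((ρ + κ').map Prod.fst) := by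
      rw [hc1, ← hfst]
      exact Measure.isProbabilityMeasure_map measurable_fst.aemeasurable
    exact Measure.isProbabilityMeasure_of_map Prod.fst
  have key := hopt _ ⟨hcp, hc1, hc2⟩
  have hρfin : ∫⁻ p, C p ∂ρ ≠ ∞ := by
    refine ne_top_of_le_ne_top hfin ?_
    rw [← hρκ, lintegral_add_measure]
    exact le_self_add
  rw [← hρκ, lintegral_add_measure, lintegral_add_measure, ENNReal.add_le_add_iff_left hρfin,
    hκ, hκ', lintegral_smul_measure, lintegral_smul_measure, smul_eq_mul, smul_eq_mul,
    ENNReal.mul_le_mul_iff_right hm0 hmtop, lintegral_finsetSum_measure,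
    lintegral_finsetSum_measure] at key
  calc ∑ i, a i ≤ ∑ i, ∫⁻ p, C p ∂(w i) := by
        refine Finset.sum_le_sum fun i _ => ?_
        calc a i = ∫⁻ _, a i ∂(w i) := by simp
          _ ≤ ∫⁻ p, C p ∂(w i) := by
            refine lintegral_mono_ae ?_
            filter_upwards [hwB i] with p hp using ha i p.1 hp.1 p.2 hp.2
    _ ≤ ∑ i, ∫⁻ p, C p ∂(w' i) := key
    _ ≤ ∑ i, b i := by
        refine Finset.sum_le_sum fun i _ => ?_
        have h1 : ∀ᵐ x ∂((w (σ i)).map Prod.fst), x ∈ U (σ i) := by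
          refine (ae_map_iff measurable_fst.aemeasurable (hU _)).mpr ?_
          filter_upwards [hwB (σ i)] with p hp using hp.1
        have h2 : ∀ᵐ y ∂((w i).map Prod.snd), y ∈ V i := by
          refine (ae_map_iff measurable_snd.aemeasurable (hV _)).mpr ?_
          filter_upwards [hwB i] with p hp using hp.2
        calc ∫⁻ p, C p ∂(w' i) ≤ ∫⁻ _, b i ∂(w' i) := by
              refine lintegral_mono_ae ?_
              filter_upwards [Measure.quasiMeasurePreserving_fst.ae h1,
                Measure.quasiMeasurePreserving_snd.ae h2] with p hp1 hp2
                using hb i p.1 hp1 p.2 hp2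
          _ = b i := by simp [hw']

/-- A set `S` is `c`-cyclically monotone. -/
def IsCyclicallyMonotone {X Y : Type*} (c : X × Y → ℝ) (S : Set (X × Y)) : Prop :=
  ∀ (n : ℕ) (p : Fin n → X × Y) (σ : Equiv.Perm (Fin n)), (∀ i, p i ∈ S) →
    ∑ i, c (p i) ≤ ∑ i, c ((p (σ i)).1, (p i).2)

/-- If `f x + g y ≤ c (x, y)` holds `γ`-a.e. and is an equality `π`-a.e., then the cost of `π` is at
most that of `γ`; no integrability is needed. -/
theorem lintegral_le_of_potentials {X Y : Type*} [MeasurableSpace X] [MeasurableSpace Y]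
    {c : X × Y → ℝ} (hc0 : ∀ p, 0 ≤ c p) {μ : Measure X} {ν : Measure Y} {π γ : Measure (X × Y)}
    (hπ : IsCoupling π μ ν) (hγ : IsCoupling γ μ ν) {f : X → ℝ} {g : Y → ℝ}
    (hf : Measurable f) (hg : Measurable g)
    (hle : ∀ᵐ p ∂γ, f p.1 + g p.2 ≤ c p) (heq : ∀ᵐ p ∂π, f p.1 + g p.2 = c p) :
    ∫⁻ p, ENNReal.ofReal (c p) ∂π ≤ ∫⁻ p, ENNReal.ofReal (c p) ∂γ := by
  obtain ⟨hπP, hπ1, hπ2⟩ := hπ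
  obtain ⟨hγP, hγ1, hγ2⟩ := hγ
  let T : ℕ → ℝ → ℝ := fun n r => max (-n) (min r n)
  have hTm : ∀ n, Measurable (T n) := fun n => by fun_prop
  have hTb : ∀ n r, ‖T n r‖ ≤ n := fun n r => by
    rw [Real.norm_eq_abs, abs_le]
    have : (0 : ℝ) ≤ n := n.cast_nonneg
    exact ⟨le_max_left _ _, max_le (by linarith) (min_le_right _ _)⟩
  have hTi : ∀ n (ρ : Measure (X × Y)) [IsProbabilityMeasure ρ] (h : X × Y → ℝ), Measurable h →
      Integrable (fun z => T n (h z)) ρ := fun n ρ _ h hh =>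
    Integrable.of_bound ((hTm n).comp hh).aestronglyMeasurable n (ae_of_all _ fun z => hTb n _)
  have hTup : ∀ n r s, T n r + T n s ≤ max (r + s) 0 := fun n r s => by
    have : (0 : ℝ) ≤ n := n.cast_nonneg
    simp only [T]
    grind
  have hTlo : ∀ n r s, 0 ≤ r + s → 0 ≤ T n r + T n s := fun n r s => by
    have : (0 : ℝ) ≤ n := n.cast_nonneg
    simp only [T]
    grind
  have hTev : ∀ r, ∀ᶠ n in atTop, T n r = r := fun r => by
    filter_upwards [eventually_ge_atTop ⌈|r|⌉₊] with n hn
    have := abs_le.mp (Nat.ceil_le.mp hn)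
    simp only [T]
    rw [min_eq_left this.2, max_eq_right this.1]
  have hstep : ∀ n, ∫⁻ p, ENNReal.ofReal (T n (f p.1) + T n (g p.2)) ∂π ≤
      ∫⁻ p, ENNReal.ofReal (c p) ∂γ := fun n => by
    have hint : ∀ ρ : Measure (X × Y), IsProbabilityMeasure ρ → ρ.map Prod.fst = μ →
        ρ.map Prod.snd = ν → Integrable (fun p : X × Y => T n (f p.1) + T n (g p.2)) ρ ∧
          ∫ p, T n (f p.1) + T n (g p.2) ∂ρ = ∫ x, T n (f x) ∂μ + ∫ y, T n (g y) ∂ν := by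
      intro ρ _ h1 h2
      have i1 := hTi n ρ _ (hf.comp measurable_fst)
      have i2 := hTi n ρ _ (hg.comp measurable_snd)
      refine ⟨i1.add i2, (integral_add i1 i2).trans ?_⟩
      have e1 := integral_map (μ := ρ) measurable_fst.aemeasurable
        ((hTm n).comp hf).aestronglyMeasurable
      have e2 := integral_map (μ := ρ) measurable_snd.aemeasurable
        ((hTm n).comp hg).aestronglyMeasurable
      rw [← h1, ← h2]
      exact congrArg₂ (· + ·) e1.symm e2.symm
    obtain ⟨i1, e1⟩ := hint π hπP hπ1 hπ2
    obtain ⟨i2, e2⟩ := hint γ hγP hγ1 hγ2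
    rw [← ofReal_integral_eq_lintegral_ofReal i1, e1, ← e2]
    · rw [integral_eq_lintegral_pos_part_sub_lintegral_neg_part i2]
      refine (ENNReal.ofReal_le_ofReal (sub_le_self _ ENNReal.toReal_nonneg)).trans ?_
      refine ENNReal.ofReal_toReal_le.trans (lintegral_mono_ae ?_)
      filter_upwards [hle] with p hp
      exact ENNReal.ofReal_le_ofReal ((hTup n _ _).trans (max_le hp (hc0 p)))
    · filter_upwards [heq] with p hp
      exact hTlo n _ _ (hp ▸ hc0 p)
  calc ∫⁻ p, ENNReal.ofReal (c p) ∂π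
      = ∫⁻ p, liminf (fun n => ENNReal.ofReal (T n (f p.1) + T n (g p.2))) atTop ∂π := by
        refine lintegral_congr_ae ?_
        filter_upwards [heq] with p hp
        refine (Tendsto.liminf_eq (tendsto_const_nhds.congr' ?_)).symm
        filter_upwards [hTev (f p.1), hTev (g p.2)] with n h1 h2
        rw [h1, h2, hp]
    _ ≤ liminf (fun n => ∫⁻ p, ENNReal.ofReal (T n (f p.1) + T n (g p.2)) ∂π) atTop := by
        refine lintegral_liminf_le fun n => ENNReal.measurable_ofReal.comp ?_
        exact ((hTm n).comp (hf.comp measurable_fst)).add ((hTm n).comp (hg.comp measurable_snd))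
    _ ≤ ∫⁻ p, ENNReal.ofReal (c p) ∂γ :=
        (liminf_le_liminf (Eventually.of_forall hstep)).trans_eq (by simp)

/-- The support of a weak limit of optimal transport plans of finite cost is cyclically monotone. -/
theorem isCyclicallyMonotone_support {X Y : Type*}
    [TopologicalSpace X] [PolishSpace X] [MeasurableSpace X] [BorelSpace X]
    [TopologicalSpace Y] [PolishSpace Y] [MeasurableSpace Y] [BorelSpace Y]
    {c : X × Y → ℝ} (hc : Continuous c) (hc0 : ∀ p, 0 ≤ c p)
    {μ : ℕ → Measure X} {ν : ℕ → Measure Y} {π : ℕ → ProbabilityMeasure (X × Y)}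
    (hπ : ∀ n, IsCoupling (π n : Measure (X × Y)) (μ n) (ν n))
    (hopt : ∀ n, ∀ γ : Measure (X × Y), IsCoupling γ (μ n) (ν n) →
      ∫⁻ p, ENNReal.ofReal (c p) ∂(π n : Measure (X × Y)) ≤ ∫⁻ p, ENNReal.ofReal (c p) ∂γ)
    (hfin : ∀ n, ∫⁻ p, ENNReal.ofReal (c p) ∂(π n : Measure (X × Y)) ≠ ⊤)
    {π' : ProbabilityMeasure (X × Y)} (hlim : Tendsto π atTop (𝓝 π')) :
    IsCyclicallyMonotone c (π' : Measure (X × Y)).support := by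
  intro n p σ hp
  have main : ∀ ε > 0, ∑ i, (c (p i) - ε) ≤ ∑ i, (c ((p (σ i)).1, (p i).2) + ε) := by
    intro ε hε
    have h1 : ∀ i, ∃ A : Set X, ∃ B : Set Y, IsOpen A ∧ IsOpen B ∧ (p i).1 ∈ A ∧ (p i).2 ∈ B ∧
        A ×ˢ B ⊆ {q | c (p i) - ε < c q} := fun i =>
      isOpen_prod_iff.mp (isOpen_lt continuous_const hc) _ _ (by simpa using hε)
    have h2 : ∀ i, ∃ A : Set X, ∃ B : Set Y, IsOpen A ∧ IsOpen B ∧ (p (σ i)).1 ∈ A ∧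
        (p i).2 ∈ B ∧ A ×ˢ B ⊆ {q | c q < c ((p (σ i)).1, (p i).2) + ε} := fun i =>
      isOpen_prod_iff.mp (isOpen_lt hc continuous_const) _ _ (by simpa using hε)
    choose A B hA hB hpA hpB hAB using h1
    choose A' B' hA' hB' hpA' hpB' hAB' using h2
    let U : Fin n → Set X := fun i => A i ∩ A' (σ.symm i)
    let V : Fin n → Set Y := fun i => B i ∩ B' i
    have hU : ∀ i, IsOpen (U i) := fun i => (hA i).inter (hA' _)
    have hV : ∀ i, IsOpen (V i) := fun i => (hB i).inter (hB' i)
    have hpos : ∀ i, 0 < (π' : Measure (X × Y)) (U i ×ˢ V i) := fun i => by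
      refine (Measure.mem_support_iff_forall _).mp (hp i) _ (((hU i).prod (hV i)).mem_nhds ?_)
      refine ⟨⟨hpA i, ?_⟩, hpB i, hpB' i⟩
      simpa using hpA' (σ.symm i)
    have hev : ∀ᶠ k in atTop, ∀ i, (π k : Measure (X × Y)) (U i ×ˢ V i) ≠ 0 := by
      refine eventually_all.mpr fun i => ?_
      have := ProbabilityMeasure.le_liminf_measure_open_of_tendsto hlim ((hU i).prod (hV i))
      filter_upwards [eventually_lt_of_lt_liminf ((hpos i).trans_le this)] with k hk using hk.ne'
    obtain ⟨k, hk⟩ := hev.exists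
    have key := sum_le_sum_of_isCoupling_of_optimal (hπ k) (hopt k) (hfin k) σ
      (fun i => (hU i).measurableSet) (fun i => (hV i).measurableSet) hk
      (a := fun i => ENNReal.ofReal (c (p i) - ε))
      (b := fun i => ENNReal.ofReal (c ((p (σ i)).1, (p i).2) + ε))
      (fun i x hx y hy => ENNReal.ofReal_le_ofReal (hAB i ⟨hx.1, hy.1⟩).le)
      (fun i x hx y hy => ENNReal.ofReal_le_ofReal
        (hAB' i ⟨by simpa using hx.2, hy.2⟩).le)
    have hb : ∀ i, 0 ≤ c ((p (σ i)).1, (p i).2) + ε := fun i => add_nonneg (hc0 _) hε.le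
    rw [← ENNReal.ofReal_sum_of_nonneg fun i _ => hb i] at key
    have hle : ENNReal.ofReal (∑ i, (c (p i) - ε)) ≤
        ENNReal.ofReal (∑ i, (c ((p (σ i)).1, (p i).2) + ε)) :=
      (Finset.le_sum_of_subadditive _ ENNReal.ofReal_zero.le
        (fun _ _ => ENNReal.ofReal_add_le) _ _).trans key
    exact (ENNReal.ofReal_le_ofReal_iff (Finset.sum_nonneg fun i _ => hb i)).mp hle
  refine le_of_tendsto_of_tendsto (b := 𝓝[>] (0 : ℝ)) (f := fun ε => ∑ i, (c (p i) - ε))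
    (g := fun ε => ∑ i, (c ((p (σ i)).1, (p i).2) + ε)) ?_ ?_ ?_
  · refine Tendsto.mono_left (Continuous.tendsto' (by fun_prop) _ _ (by simp)) nhdsWithin_le_nhds
  · refine Tendsto.mono_left (Continuous.tendsto' (by fun_prop) _ _ (by simp)) nhdsWithin_le_nhds
  · filter_upwards [self_mem_nhdsWithin] with ε hε using main ε hε

/-- The value at `x` of the `c`-chain `p 0, …, p n`. -/
def chainCost {X Y : Type*} (c : X × Y → ℝ) (n : ℕ) (p : ℕ → X × Y) (x : X) : ℝ :=
  ∑ i ∈ Finset.range n, (c ((p (i + 1)).1, (p i).2) - c (p i)) + (c (x, (p n).2) - c (p n))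

/-- Closed chains in a cyclically monotone set have nonnegative value. -/
theorem IsCyclicallyMonotone.chainCost_nonneg {X Y : Type*} {c : X × Y → ℝ} {S : Set (X × Y)}
    (hS : IsCyclicallyMonotone c S) (n : ℕ) {p : ℕ → X × Y} (hp : ∀ i, p i ∈ S) :
    0 ≤ chainCost c n p (p 0).1 := by
  have h := hS (n + 1) (fun i => p i) (finRotate (n + 1)) fun i => hp i
  rw [← sub_nonneg, ← Finset.sum_sub_distrib, Fin.sum_univ_castSucc] at h
  simpa [chainCost, Finset.sum_range] using h

/-- Appending a point to a chain. -/
theorem exists_chainCost_eq_add {X Y : Type*} (c : X × Y → ℝ) {S : Set (X × Y)} (n : ℕ)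
    {p : ℕ → X × Y} (hp : ∀ i, p i ∈ S) {q : X × Y} (hq : q ∈ S) :
    ∃ p' : ℕ → X × Y, (∀ i, p' i ∈ S) ∧ p' 0 = p 0 ∧
      ∀ x, chainCost c (n + 1) p' x = chainCost c n p q.1 + (c (x, q.2) - c q) := by
  refine ⟨fun i => if i ≤ n then p i else q, fun i => ?_, by simp, fun x => ?_⟩
  · dsimp only
    split_ifs
    exacts [hp i, hq]
  · have : ∀ i ∈ Finset.range n,
        c ((if i + 1 ≤ n then p (i + 1) else q).1, (if i ≤ n then p i else q).2) -
          c (if i ≤ n then p i else q) = c ((p (i + 1)).1, (p i).2) - c (p i) := fun i hi => by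
      have hi := Finset.mem_range.mp hi
      rw [if_pos (show i + 1 ≤ n by lia), if_pos hi.le]
    rw [chainCost, Finset.sum_range_succ, Finset.sum_congr rfl this]
    simp [chainCost]

/-- A transport plan concentrated on a cyclically monotone set for a continuous finite cost is
optimal. -/
theorem IsCyclicallyMonotone.lintegral_le {X Y : Type*}
    [TopologicalSpace X] [MeasurableSpace X] [OpensMeasurableSpace X]
    [TopologicalSpace Y] [MeasurableSpace Y] [OpensMeasurableSpace Y]
    {c : X × Y → ℝ} (hc : Continuous c) (hc0 : ∀ p, 0 ≤ c p) {S : Set (X × Y)}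
    (hS : IsCyclicallyMonotone c S) {μ : Measure X} {ν : Measure Y} {π γ : Measure (X × Y)}
    (hπ : IsCoupling π μ ν) (hγ : IsCoupling γ μ ν) (hπS : ∀ᵐ p ∂π, p ∈ S) :
    ∫⁻ p, ENNReal.ofReal (c p) ∂π ≤ ∫⁻ p, ENNReal.ofReal (c p) ∂γ := by
  have hπP := hπ.1
  obtain ⟨p₀, hp₀⟩ := hπS.exists
  let I := {q : ℕ × (ℕ → X × Y) // (∀ i, q.2 i ∈ S) ∧ q.2 0 = p₀}
  let φ : X → EReal := fun x => ⨅ q : I, (chainCost c q.1.1 q.1.2 x : EReal)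
  have hφm : Measurable φ := by
    refine UpperSemicontinuous.measurable (upperSemicontinuous_iInf fun q => ?_)
    refine (continuous_coe_real_ereal.comp ?_).upperSemicontinuous
    unfold chainCost
    fun_prop
  have hφtop : ∀ x, φ x ≠ ⊤ := fun x =>
    ((iInf_le _ (⟨(0, fun _ => p₀), fun _ => hp₀, rfl⟩ : I)).trans_lt (EReal.coe_lt_top _)).ne
  have hφle : ∀ q ∈ S, ∀ x, φ x + (c q - c (x, q.2) : ℝ) ≤ φ q.1 := by
    intro q hq x
    refine le_iInf fun ⟨⟨n, p⟩, hp, hp0⟩ => ?_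
    obtain ⟨p', hp', hp'0, hcost⟩ := exists_chainCost_eq_add c n hp hq
    have h : φ x ≤ _ := iInf_le _ (⟨(n + 1, p'), hp', hp'0.trans hp0⟩ : I)
    refine (add_le_add_left h _).trans_eq ?_
    rw [← EReal.coe_add, hcost]
    congr 1
    ring
  have hφ0 : 0 ≤ φ p₀.1 := by
    refine le_iInf fun ⟨⟨n, p⟩, hp, hp0⟩ => ?_
    have h := hS.chainCost_nonneg n hp
    rw [hp0] at h
    exact_mod_cast h
  have hφbot : ∀ q ∈ S, φ q.1 ≠ ⊥ := fun q hq h => by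
    have := (add_le_add_left hφ0 _).trans (hφle q hq p₀.1)
    rw [h, zero_add] at this
    exact EReal.coe_ne_bot _ (le_bot_iff.mp this)
  let A : Set X := {x | φ x ≠ ⊥}
  have hA : MeasurableSet A := (hφm (measurableSet_singleton ⊥)).compl
  let ψ : Y → EReal := fun y => ⨅ x : A, ((c (x, y) - (φ x).toReal : ℝ) : EReal)
  have hψm : Measurable ψ := by
    refine UpperSemicontinuous.measurable (upperSemicontinuous_iInf fun x => ?_)
    refine (continuous_coe_real_ereal.comp ?_).upperSemicontinuous
    fun_prop
  have hψle : ∀ x ∈ A, ∀ y, ψ y ≤ (c (x, y) - (φ x).toReal : ℝ) := fun x hx y =>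
    iInf_le (fun x : A => ((c (x, y) - (φ x).toReal : ℝ) : EReal)) ⟨x, hx⟩
  have hψeq : ∀ q ∈ S, ψ q.2 = (c q - (φ q.1).toReal : ℝ) := by
    intro q hq
    refine le_antisymm (hψle q.1 (hφbot q hq) q.2) (le_iInf fun ⟨x, hx⟩ => ?_)
    have h := hφle q hq x
    rw [← EReal.coe_toReal (hφtop x) hx, ← EReal.coe_toReal (hφtop q.1) (hφbot q hq),
      ← EReal.coe_add, EReal.coe_le_coe_iff] at h
    rw [EReal.coe_le_coe_iff]
    linarith
  let B : Set Y := {y | ψ y ≠ ⊥}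
  have hB : MeasurableSet B := (hψm (measurableSet_singleton ⊥)).compl
  have hγA : ∀ᵐ p ∂γ, p.1 ∈ A := by
    refine (ae_map_iff measurable_fst.aemeasurable hA).mp ?_
    rw [hγ.2.1, ← hπ.2.1]
    refine (ae_map_iff measurable_fst.aemeasurable hA).mpr ?_
    filter_upwards [hπS] with q hq using hφbot q hq
  have hγB : ∀ᵐ p ∂γ, p.2 ∈ B := by
    refine (ae_map_iff measurable_snd.aemeasurable hB).mp ?_
    rw [hγ.2.2, ← hπ.2.2]
    refine (ae_map_iff measurable_snd.aemeasurable hB).mpr ?_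
    filter_upwards [hπS] with q hq
    exact (hψeq q hq).trans_ne (EReal.coe_ne_bot _)
  refine lintegral_le_of_potentials hc0 hπ hγ hφm.ereal_toReal hψm.ereal_toReal ?_ ?_
  · filter_upwards [hγA, hγB] with p hpA hpB
    have h := EReal.toReal_le_toReal (hψle p.1 hpA p.2) hpB (EReal.coe_ne_top _)
    rw [EReal.toReal_coe] at h
    linarith
  · filter_upwards [hπS] with q hq
    rw [hψeq q hq, EReal.toReal_coe]
    ring

/-- Weak limits of transport plans are transport plans between the weak limits of the marginals. -/
theorem IsCoupling.of_tendsto {X Y : Type*}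
    [TopologicalSpace X] [PolishSpace X] [MeasurableSpace X] [BorelSpace X]
    [TopologicalSpace Y] [PolishSpace Y] [MeasurableSpace Y] [BorelSpace Y]
    {μ : ℕ → ProbabilityMeasure X} {ν : ℕ → ProbabilityMeasure Y}
    {π : ℕ → ProbabilityMeasure (X × Y)}
    {μ' : ProbabilityMeasure X} {ν' : ProbabilityMeasure Y} {π' : ProbabilityMeasure (X × Y)}
    (hπ : ∀ n, IsCoupling (π n : Measure (X × Y)) (μ n) (ν n))
    (hμ : Tendsto μ atTop (𝓝 μ')) (hν : Tendsto ν atTop (𝓝 ν'))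
    (hlim : Tendsto π atTop (𝓝 π')) :
    IsCoupling (π' : Measure (X × Y)) μ' ν' := by
  have h1 := ProbabilityMeasure.tendsto_map_of_tendsto_of_continuous π π' hlim continuous_fst
  have h2 := ProbabilityMeasure.tendsto_map_of_tendsto_of_continuous π π' hlim continuous_snd
  have e1 : ∀ n, (π n).map continuous_fst.measurable.aemeasurable = μ n := fun n =>
    Subtype.ext (hπ n).2.1
  have e2 : ∀ n, (π n).map continuous_snd.measurable.aemeasurable = ν n := fun n =>
    Subtype.ext (hπ n).2.2
  simp only [e1] at h1
  simp only [e2] at h2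
  exact ⟨inferInstance, congrArg ProbabilityMeasure.toMeasure (tendsto_nhds_unique h1 hμ),
    congrArg ProbabilityMeasure.toMeasure (tendsto_nhds_unique h2 hν)⟩

/-- A weakly convergent sequence of probability measures on a Polish space is tight. -/
theorem isTightMeasureSet_range_of_tendsto {X : Type*}
    [TopologicalSpace X] [PolishSpace X] [MeasurableSpace X] [BorelSpace X]
    {μ : ℕ → ProbabilityMeasure X} {μ' : ProbabilityMeasure X} (hμ : Tendsto μ atTop (𝓝 μ')) :
    IsTightMeasureSet (Set.range fun n => (μ n : Measure X)) := by
  let := TopologicalSpace.upgradeIsCompletelyMetrizable X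
  have h := isTightMeasureSet_of_isCompact_closure (S := insert μ' (Set.range μ))
    hμ.isCompact_insert_range.closure
  refine h.subset ?_
  rintro _ ⟨n, rfl⟩
  exact ⟨μ n, Or.inr ⟨n, rfl⟩, rfl⟩

/-- A sequence of transport plans with weakly convergent marginals has a weakly convergent
subsequence. -/
theorem exists_tendsto_subseq_of_isCoupling {X Y : Type*}
    [TopologicalSpace X] [PolishSpace X] [MeasurableSpace X] [BorelSpace X]
    [TopologicalSpace Y] [PolishSpace Y] [MeasurableSpace Y] [BorelSpace Y]
    {μ : ℕ → ProbabilityMeasure X} {ν : ℕ → ProbabilityMeasure Y}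
    {π : ℕ → ProbabilityMeasure (X × Y)}
    {μ' : ProbabilityMeasure X} {ν' : ProbabilityMeasure Y}
    (hπ : ∀ n, IsCoupling (π n : Measure (X × Y)) (μ n) (ν n))
    (hμ : Tendsto μ atTop (𝓝 μ')) (hν : Tendsto ν atTop (𝓝 ν')) :
    ∃ π' : ProbabilityMeasure (X × Y), ∃ nk : ℕ → ℕ, StrictMono nk ∧
      Tendsto (π ∘ nk) atTop (𝓝 π') := by
  have htight : IsTightMeasureSet {((ρ : ProbabilityMeasure (X × Y)) : Measure (X × Y)) |
      ρ ∈ Set.range π} := by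
    refine IsTightMeasureSet.prodMk ((isTightMeasureSet_range_of_tendsto hμ).subset ?_)
      ((isTightMeasureSet_range_of_tendsto hν).subset ?_)
    · rintro _ ⟨_, ⟨_, ⟨n, rfl⟩, rfl⟩, rfl⟩
      exact ⟨n, (hπ n).2.1.symm⟩
    · rintro _ ⟨_, ⟨_, ⟨n, rfl⟩, rfl⟩, rfl⟩
      exact ⟨n, (hπ n).2.2.symm⟩
  obtain ⟨π', -, nk, hnk, h⟩ := (isCompact_closure_of_isTightMeasureSet htight).tendsto_subseq
    fun n => subset_closure (Set.mem_range_self n)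
  exact ⟨π', nk, hnk, h⟩

/-- **Schachermayer–Teichmann stability theorem.** Let `X`, `Y` be Polish spaces,
`c : X × Y → [0,∞)` a finitely valued continuous cost, `μ_n → μ` and `ν_n → ν` weakly,
and let `π_n` be an optimizer of the transport problem `(c, μ_n, ν_n)`, with finite
optimal values. Then some subsequence `π_{n_k}` converges weakly to a transport plan
`π ∈ ADM(μ,ν)` optimizing the Monge–Kantorovich problem for `(c, μ, ν)`; moreover every
weak limit point of `(π_n)` along a subsequence is such an optimizer. -/
theorem stmt_14 {X Y : Type*}
    [TopologicalSpace X] [PolishSpace X] [MeasurableSpace X] [BorelSpace X]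
    [TopologicalSpace Y] [PolishSpace Y] [MeasurableSpace Y] [BorelSpace Y]
    (c : X × Y → ℝ) (hc : Continuous c) (hc0 : ∀ p, 0 ≤ c p)
    (μ : ℕ → Measure X) (ν : ℕ → Measure Y)
    (μlim : Measure X) (νlim : Measure Y)
    (hμP : ∀ n, IsProbabilityMeasure (μ n)) (hνP : ∀ n, IsProbabilityMeasure (ν n))
    [IsProbabilityMeasure μlim] [IsProbabilityMeasure νlim]
    (hμ : WeakTendsto μ μlim) (hν : WeakTendsto ν νlim)
    (π : ℕ → Measure (X × Y))
    (hπadm : ∀ n, IsCoupling (π n) (μ n) (ν n))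
    (hπopt : ∀ n, ∀ γ : Measure (X × Y), IsCoupling γ (μ n) (ν n) →
      ∫⁻ p, ENNReal.ofReal (c p) ∂(π n) ≤ ∫⁻ p, ENNReal.ofReal (c p) ∂γ)
    (hfin : ∀ n, ∫⁻ p, ENNReal.ofReal (c p) ∂(π n) ≠ ⊤) :
    (∃ nk : ℕ → ℕ, StrictMono nk ∧ ∃ πlim : Measure (X × Y),
      IsCoupling πlim μlim νlim ∧ WeakTendsto (fun j => π (nk j)) πlim ∧
      ∀ γ : Measure (X × Y), IsCoupling γ μlim νlim →
        ∫⁻ p, ENNReal.ofReal (c p) ∂πlim ≤ ∫⁻ p, ENNReal.ofReal (c p) ∂γ) ∧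
    ∀ nk : ℕ → ℕ, StrictMono nk → ∀ π' : Measure (X × Y), IsProbabilityMeasure π' →
      WeakTendsto (fun j => π (nk j)) π' →
      IsCoupling π' μlim νlim ∧
      ∀ γ : Measure (X × Y), IsCoupling γ μlim νlim →
        ∫⁻ p, ENNReal.ofReal (c p) ∂π' ≤ ∫⁻ p, ENNReal.ofReal (c p) ∂γ := by
  obtain ⟨μ, rfl⟩ : ∃ ρ : ℕ → ProbabilityMeasure X, (fun n => (ρ n : Measure X)) = μ :=
    ⟨fun n => ⟨μ n, hμP n⟩, rfl⟩
  obtain ⟨ν, rfl⟩ : ∃ ρ : ℕ → ProbabilityMeasure Y, (fun n => (ρ n : Measure Y)) = ν :=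
    ⟨fun n => ⟨ν n, hνP n⟩, rfl⟩
  obtain ⟨π, rfl⟩ : ∃ ρ : ℕ → ProbabilityMeasure (X × Y),
      (fun n => (ρ n : Measure (X × Y))) = π := ⟨fun n => ⟨π n, (hπadm n).1⟩, rfl⟩
  let μ' : ProbabilityMeasure X := ⟨μlim, inferInstance⟩
  let ν' : ProbabilityMeasure Y := ⟨νlim, inferInstance⟩
  have hμ' : Tendsto μ atTop (𝓝 μ') := ProbabilityMeasure.tendsto_iff_forall_integral_tendsto.mpr hμ
  have hν' : Tendsto ν atTop (𝓝 ν') := ProbabilityMeasure.tendsto_iff_forall_integral_tendsto.mpr hν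
  have main : ∀ nk : ℕ → ℕ, StrictMono nk → ∀ π' : ProbabilityMeasure (X × Y),
      Tendsto (π ∘ nk) atTop (𝓝 π') → IsCoupling (π' : Measure (X × Y)) μlim νlim ∧
      ∀ γ : Measure (X × Y), IsCoupling γ μlim νlim →
        ∫⁻ p, ENNReal.ofReal (c p) ∂(π' : Measure (X × Y)) ≤ ∫⁻ p, ENNReal.ofReal (c p) ∂γ := by
    intro nk hnk π' hlim
    have hcoup : IsCoupling (π' : Measure (X × Y)) μlim νlim :=
      IsCoupling.of_tendsto (μ' := μ') (ν' := ν') (fun n => hπadm (nk n))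
        (hμ'.comp hnk.tendsto_atTop) (hν'.comp hnk.tendsto_atTop) hlim
    have hmono := isCyclicallyMonotone_support hc hc0 (fun n => hπadm (nk n))
      (fun n => hπopt (nk n)) (fun n => hfin (nk n)) hlim
    exact ⟨hcoup, fun γ hγ => hmono.lintegral_le hc hc0 hcoup hγ Measure.support_mem_ae⟩
  refine ⟨?_, fun nk hnk π' hπ' hlim => main nk hnk ⟨π', hπ'⟩
    (ProbabilityMeasure.tendsto_iff_forall_integral_tendsto.mpr hlim)⟩
  obtain ⟨π', nk, hnk, hlim⟩ := exists_tendsto_subseq_of_isCoupling hπadm hμ' hν'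
  obtain ⟨hcoup, hopt⟩ := main nk hnk π' hlim
  exact ⟨nk, hnk, π', hcoup, ProbabilityMeasure.tendsto_iff_forall_integral_tendsto.mp hlim, hopt⟩
end

section
/- Let c : [0,1]² → ℝ be continuous. For n ≥ 1 let I^n_{i,j} = [(i−1)/2ⁿ, i/2ⁿ) × [(j−1)/2ⁿ, j/2ⁿ) for i,j = 1,…,2ⁿ, and define the step functions c̲_n(x,y) = min over the closure of I^n_{i,j} of c, and c̄_n(x,y) = max over the closure of I^n_{i,j} of c, for (x,y) ∈ I^n_{i,j}. Let γ̲ⁿ and γ̄ⁿ be copula measures maximizing ∫ c̲_n dγ and ∫ c̄_n dγ respectively over all copula measures. Then lim_{n→∞} ∫_{[0,1)²} c̲_n dγ̲ⁿ = lim_{n→∞} ∫_{[0,1)²} c̄_n dγ̄ⁿ = sup over copula measures γ of ∫_{[0,1)²} c dγ. -/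
open MeasureTheory Filter Topology

/-- The closed dyadic square of generation `n` containing the point `p` (the closure of
the half-open dyadic square `I^n_{i,j}` containing `p`). -/
def dyadicSquare (n : ℕ) (p : ℝ × ℝ) : Set (ℝ × ℝ) :=
  Set.Icc ((⌊p.1 * 2 ^ n⌋ : ℝ) / 2 ^ n) (((⌊p.1 * 2 ^ n⌋ : ℝ) + 1) / 2 ^ n) ×ˢ
    Set.Icc ((⌊p.2 * 2 ^ n⌋ : ℝ) / 2 ^ n) (((⌊p.2 * 2 ^ n⌋ : ℝ) + 1) / 2 ^ n)

/-- The lower piecewise constant approximation `c̲_n` of `c`: on each dyadic square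
`I^n_{i,j}` it equals the minimum of `c` on the closure of that square. -/
noncomputable def lowerApprox (c : ℝ × ℝ → ℝ) (n : ℕ) (p : ℝ × ℝ) : ℝ :=
  sInf (c '' dyadicSquare n p)

/-- The upper piecewise constant approximation `c̄_n` of `c`: on each dyadic square
`I^n_{i,j}` it equals the maximum of `c` on the closure of that square. -/
noncomputable def upperApprox (c : ℝ × ℝ → ℝ) (n : ℕ) (p : ℝ × ℝ) : ℝ :=
  sSup (c '' dyadicSquare n p)

theorem mem_dyadicSquare_self (n : ℕ) (p : ℝ × ℝ) : p ∈ dyadicSquare n p := by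
  have h2 : (0 : ℝ) < 2 ^ n := by positivity
  refine ⟨⟨?_, ?_⟩, ⟨?_, ?_⟩⟩
  · exact (div_le_iff₀ h2).2 (Int.floor_le _)
  · exact (le_div_iff₀ h2).2 (Int.lt_floor_add_one _).le
  · exact (div_le_iff₀ h2).2 (Int.floor_le _)
  · exact (le_div_iff₀ h2).2 (Int.lt_floor_add_one _).le

theorem dist_le_of_mem_dyadicSquare {n : ℕ} {p q : ℝ × ℝ} (hq : q ∈ dyadicSquare n p) :
    dist q p ≤ (1 / 2) ^ n := by
  obtain ⟨hp₁, hp₂⟩ := mem_dyadicSquare_self n p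
  obtain ⟨hq₁, hq₂⟩ := hq
  have key (a : ℝ) : (a + 1) / 2 ^ n - a / 2 ^ n = (1 / 2) ^ n := by
    rw [one_div_pow]; ring
  rw [Prod.dist_eq]
  exact max_le ((Real.dist_le_of_mem_Icc hq₁ hp₁).trans_eq (key _))
    ((Real.dist_le_of_mem_Icc hq₂ hp₂).trans_eq (key _))

theorem Icc_floor_dyadic_subset (n : ℕ) {x : ℝ} (hx : x ∈ Set.Ico (0 : ℝ) 1) :
    Set.Icc ((⌊x * 2 ^ n⌋ : ℝ) / 2 ^ n) (((⌊x * 2 ^ n⌋ : ℝ) + 1) / 2 ^ n) ⊆ Set.Icc 0 1 := by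
  have h2 : (0 : ℝ) < 2 ^ n := by positivity
  have h0 : (0 : ℤ) ≤ ⌊x * 2 ^ n⌋ := Int.floor_nonneg.2 (mul_nonneg hx.1 h2.le)
  have h1 : ⌊x * 2 ^ n⌋ < (2 ^ n : ℤ) := by
    rw [Int.floor_lt]
    push_cast
    nlinarith [hx.2]
  apply Set.Icc_subset_Icc
  · have : (0 : ℝ) ≤ ⌊x * 2 ^ n⌋ := by exact_mod_cast h0
    positivity
  · rw [div_le_one h2]
    exact_mod_cast h1

theorem dyadicSquare_subset (n : ℕ) {p : ℝ × ℝ}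
    (hp : p ∈ Set.Ico (0 : ℝ) 1 ×ˢ Set.Ico (0 : ℝ) 1) :
    dyadicSquare n p ⊆ Set.Icc 0 1 ×ˢ Set.Icc 0 1 :=
  Set.prod_mono (Icc_floor_dyadic_subset n hp.1) (Icc_floor_dyadic_subset n hp.2)

theorem measurable_comp_floor_dyadic (G : ℤ × ℤ → ℝ) (n : ℕ) :
    Measurable fun p : ℝ × ℝ => G (⌊p.1 * 2 ^ n⌋, ⌊p.2 * 2 ^ n⌋) := by
  have hf : Measurable fun p : ℝ × ℝ => (⌊p.1 * 2 ^ n⌋, ⌊p.2 * 2 ^ n⌋) :=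
    (measurable_fst.mul_const _).floor.prodMk (measurable_snd.mul_const _).floor
  exact (measurable_of_countable G).comp hf

/-- A function of the dyadic square is measurable, as there are countably many squares. -/
theorem measurable_comp_dyadicSquare (F : Set (ℝ × ℝ) → ℝ) (n : ℕ) :
    Measurable fun p => F (dyadicSquare n p) :=
  measurable_comp_floor_dyadic (fun k => F
    (Set.Icc ((k.1 : ℝ) / 2 ^ n) (((k.1 : ℝ) + 1) / 2 ^ n) ×ˢ
      Set.Icc ((k.2 : ℝ) / 2 ^ n) (((k.2 : ℝ) + 1) / 2 ^ n))) n

theorem ae_unif_mem_Ico : ∀ᵐ x ∂unif, x ∈ Set.Ico (0 : ℝ) 1 := by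
  rw [unif, ← restrict_Ico_eq_restrict_Icc]
  exact ae_restrict_mem measurableSet_Ico

theorem IsCopula.ae_mem_Ico {γ : Measure (ℝ × ℝ)} (hγ : IsCopula γ) :
    ∀ᵐ p ∂γ, p ∈ Set.Ico (0 : ℝ) 1 ×ˢ Set.Ico (0 : ℝ) 1 := by
  have h₁ := ae_unif_mem_Ico
  have h₂ := ae_unif_mem_Ico
  rw [← hγ.2.1] at h₁
  rw [← hγ.2.2] at h₂
  filter_upwards [ae_of_ae_map measurable_fst.aemeasurable h₁,
    ae_of_ae_map measurable_snd.aemeasurable h₂] with p hp₁ hp₂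
  exact ⟨hp₁, hp₂⟩

theorem IsCopula.integrable_of_continuousOn {γ : Measure (ℝ × ℝ)} (hγ : IsCopula γ)
    {c : ℝ × ℝ → ℝ} (hc : ContinuousOn c (Set.Icc 0 1 ×ˢ Set.Icc 0 1)) : Integrable c γ := by
  have := hγ.1
  have hae : ∀ᵐ p ∂γ, p ∈ Set.Icc (0 : ℝ) 1 ×ˢ Set.Icc (0 : ℝ) 1 :=
    hγ.ae_mem_Ico.mono fun p hp =>
      Set.prod_mono Set.Ico_subset_Icc_self Set.Ico_subset_Icc_self hp
  rw [← Measure.restrict_eq_self_of_ae_mem hae]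
  exact hc.integrableOn_compact (isCompact_Icc.prod isCompact_Icc)

theorem eventually_image_dyadicSquare_subset {c : ℝ × ℝ → ℝ}
    (hc : ContinuousOn c (Set.Icc 0 1 ×ˢ Set.Icc 0 1)) {ε : ℝ} (hε : 0 < ε) :
    ∀ᶠ n : ℕ in atTop, ∀ p ∈ Set.Ico (0 : ℝ) 1 ×ˢ Set.Ico (0 : ℝ) 1,
      c '' dyadicSquare n p ⊆ Set.Icc (c p - ε) (c p + ε) := by
  have hu := (isCompact_Icc.prod isCompact_Icc).uniformContinuousOn_of_continuous hc
  obtain ⟨δ, hδ, h⟩ := Metric.uniformContinuousOn_iff.1 hu ε hε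
  have hlim : Tendsto (fun n : ℕ => (1 / 2 : ℝ) ^ n) atTop (𝓝 0) :=
    tendsto_pow_atTop_nhds_zero_of_lt_one (by norm_num) (by norm_num)
  filter_upwards [hlim.eventually_lt_const hδ] with n hn p hp
  rintro _ ⟨q, hq, rfl⟩
  have hsub := dyadicSquare_subset n hp
  have := h q (hsub hq) p (hsub (mem_dyadicSquare_self n p))
    ((dist_le_of_mem_dyadicSquare hq).trans_lt hn)
  rw [Real.dist_eq, abs_lt] at this
  constructor <;> linarith

theorem abs_sInf_sub_le {S : Set ℝ} {a ε : ℝ} (ha : a ∈ S)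
    (hS : S ⊆ Set.Icc (a - ε) (a + ε)) : |sInf S - a| ≤ ε := by
  have h₁ : a - ε ≤ sInf S := le_csInf ⟨a, ha⟩ fun _ hx => (hS hx).1
  have h₂ : sInf S ≤ a := csInf_le ⟨a - ε, fun _ hx => (hS hx).1⟩ ha
  rw [abs_le]
  constructor <;> linarith [(hS ha).1]

theorem abs_sSup_sub_le {S : Set ℝ} {a ε : ℝ} (ha : a ∈ S)
    (hS : S ⊆ Set.Icc (a - ε) (a + ε)) : |sSup S - a| ≤ ε := by
  have h₁ : sSup S ≤ a + ε := csSup_le ⟨a, ha⟩ fun _ hx => (hS hx).2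
  have h₂ : a ≤ sSup S := le_csSup ⟨a + ε, fun _ hx => (hS hx).2⟩ ha
  rw [abs_le]
  constructor <;> linarith [(hS ha).1]

theorem IsCopula.abs_integral_sub_le {γ : Measure (ℝ × ℝ)} (hγ : IsCopula γ)
    {f c : ℝ × ℝ → ℝ} (hf : Measurable f) (hc : Integrable c γ) {ε : ℝ}
    (h : ∀ p ∈ Set.Ico (0 : ℝ) 1 ×ˢ Set.Ico (0 : ℝ) 1, |f p - c p| ≤ ε) :
    |∫ p, f p ∂γ - ∫ p, c p ∂γ| ≤ ε := by
  have := hγ.1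
  have hae : ∀ᵐ p ∂γ, ‖f p - c p‖ ≤ ε := hγ.ae_mem_Ico.mono h
  have hsub : Integrable (fun p => f p - c p) γ :=
    Integrable.of_bound (hf.aestronglyMeasurable.sub hc.aestronglyMeasurable) ε hae
  have hfi : Integrable f γ := by
    simpa [Pi.add_def] using hsub.add hc
  rw [← integral_sub hfi hc]
  simpa using norm_integral_le_of_norm_le_const hae

/-- Values of maximizers converge to the supremum when the functionals converge uniformly. -/
theorem tendsto_integral_maximizer {c : ℝ × ℝ → ℝ} {f : ℕ → ℝ × ℝ → ℝ}
    {μ : ℕ → Measure (ℝ × ℝ)}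
    (hμ : ∀ n, IsCopula (μ n) ∧ ∀ γ : Measure (ℝ × ℝ), IsCopula γ →
      ∫ p, f n p ∂γ ≤ ∫ p, f n p ∂(μ n))
    (hf : ∀ ε > 0, ∀ᶠ n in atTop, ∀ γ : Measure (ℝ × ℝ), IsCopula γ →
      |∫ p, f n p ∂γ - ∫ p, c p ∂γ| ≤ ε) :
    Tendsto (fun n => ∫ p, f n p ∂(μ n)) atTop
      (𝓝 (sSup {r : ℝ | ∃ γ : Measure (ℝ × ℝ), IsCopula γ ∧ r = ∫ p, c p ∂γ})) := by
  rw [Metric.tendsto_nhds]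
  intro ε hε
  filter_upwards [hf (ε / 2) (half_pos hε)] with n hn
  have hub : ∀ r ∈ {r : ℝ | ∃ γ : Measure (ℝ × ℝ), IsCopula γ ∧ r = ∫ p, c p ∂γ},
      r ≤ ∫ p, f n p ∂(μ n) + ε / 2 := by
    rintro _ ⟨γ, hγ, rfl⟩
    linarith [(abs_le.1 (hn γ hγ)).1, (hμ n).2 γ hγ]
  have hmem : ∫ p, c p ∂(μ n) ∈ {r : ℝ | ∃ γ : Measure (ℝ × ℝ), IsCopula γ ∧ r = ∫ p, c p ∂γ} :=
    ⟨μ n, (hμ n).1, rfl⟩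
  have h₁ := csSup_le (Set.nonempty_of_mem hmem) hub
  have h₂ := le_csSup ⟨_, hub⟩ hmem
  have h₃ := (abs_le.1 (hn (μ n) (hμ n).1)).2
  rw [Real.dist_eq, abs_lt]
  constructor <;> linarith

/-- **Convergence of dyadic approximations (Hofer–Iacò).** Let `c : [0,1]² → ℝ` be
continuous, let `c̲_n`, `c̄_n` be its lower/upper dyadic step approximations, and for
each `n` let `γ̲ⁿ`, `γ̄ⁿ` be copula measures maximizing `∫ c̲_n dγ`, `∫ c̄_n dγ` over all
copula measures. Then both `∫ c̲_n dγ̲ⁿ` and `∫ c̄_n dγ̄ⁿ` converge to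
`sup_γ ∫ c dγ`, the supremum over copula measures. -/
theorem stmt_15 (c : ℝ × ℝ → ℝ)
    (hc : ContinuousOn c (Set.Icc 0 1 ×ˢ Set.Icc 0 1))
    (γlow γup : ℕ → Measure (ℝ × ℝ))
    (hγlow : ∀ n, IsCopula (γlow n) ∧ ∀ γ : Measure (ℝ × ℝ), IsCopula γ →
      ∫ p, lowerApprox c n p ∂γ ≤ ∫ p, lowerApprox c n p ∂(γlow n))
    (hγup : ∀ n, IsCopula (γup n) ∧ ∀ γ : Measure (ℝ × ℝ), IsCopula γ →
      ∫ p, upperApprox c n p ∂γ ≤ ∫ p, upperApprox c n p ∂(γup n)) :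
    Tendsto (fun n => ∫ p, lowerApprox c n p ∂(γlow n)) atTop
      (𝓝 (sSup {r : ℝ | ∃ γ : Measure (ℝ × ℝ), IsCopula γ ∧ r = ∫ p, c p ∂γ})) ∧
    Tendsto (fun n => ∫ p, upperApprox c n p ∂(γup n)) atTop
      (𝓝 (sSup {r : ℝ | ∃ γ : Measure (ℝ × ℝ), IsCopula γ ∧ r = ∫ p, c p ∂γ})) := by
  constructor
  · refine tendsto_integral_maximizer hγlow fun ε hε => ?_
    filter_upwards [eventually_image_dyadicSquare_subset hc hε] with n hn γ hγ
    exact hγ.abs_integral_sub_le (measurable_comp_dyadicSquare (fun S => sInf (c '' S)) n)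
      (hγ.integrable_of_continuousOn hc) fun p hp =>
        abs_sInf_sub_le (Set.mem_image_of_mem c (mem_dyadicSquare_self n p)) (hn p hp)
  · refine tendsto_integral_maximizer hγup fun ε hε => ?_
    filter_upwards [eventually_image_dyadicSquare_subset hc hε] with n hn γ hγ
    exact hγ.abs_integral_sub_le (measurable_comp_dyadicSquare (fun S => sSup (c '' S)) n)
      (hγ.integrable_of_continuousOn hc) fun p hp =>
        abs_sSup_sub_le (Set.mem_image_of_mem c (mem_dyadicSquare_self n p)) (hn p hp)
end

section
/- Let X and Y be Polish spaces, μ and ν Borel probability measures on X and Y respectively, and c : X × Y → ℝ a bounded continuous cost function. Let f : X → ℝ be a bounded measurable function and suppose γ ∈ ADM(μ,ν) is concentrated on the c-subdifferential of f, i.e., γ({(x,y) : f(z) − f(x) ≥ c(z,y) − c(x,y) for all z ∈ X}) = 1. Then γ is an optimal c-coupling in the maximization sense: for every γ' ∈ ADM(μ,ν), ∫_{X×Y} c dγ' ≤ ∫_{X×Y} c dγ. -/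
open MeasureTheory

/-- The `c`-transform `y ↦ ⨆ z, c (z, y) - f z` is measurable, being a supremum of continuous
functions. -/
lemma measurable_iSup_sub_of_continuous {X Y : Type*} [TopologicalSpace X]
    [TopologicalSpace Y] [MeasurableSpace Y] [OpensMeasurableSpace Y]
    {c : X × Y → ℝ} (hc : Continuous c) {f : X → ℝ}
    (hbdd : ∀ y, BddAbove (Set.range fun z => c (z, y) - f z)) :
    Measurable fun y => ⨆ z, (c (z, y) - f z) := by
  refine LowerSemicontinuous.measurable (lowerSemicontinuous_ciSup hbdd fun z => ?_)
  exact Continuous.lowerSemicontinuous (by fun_prop)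

/-- The integral of `f x + g y` against a coupling depends only on its marginals. -/
lemma integral_fst_add_snd {X Y : Type*} [MeasurableSpace X] [MeasurableSpace Y]
    (γ : Measure (X × Y)) {f : X → ℝ} {g : Y → ℝ}
    (hf : Integrable f (γ.map Prod.fst)) (hg : Integrable g (γ.map Prod.snd)) :
    ∫ p, (f p.1 + g p.2) ∂γ = ∫ x, f x ∂γ.map Prod.fst + ∫ y, g y ∂γ.map Prod.snd := by
  rw [integral_map measurable_fst.aemeasurable hf.1,
    integral_map measurable_snd.aemeasurable hg.1]
  exact integral_add (hf.comp_measurable measurable_fst) (hg.comp_measurable measurable_snd)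

/-- **Sufficiency of the c-subdifferential criterion (maximization sense).** Let `X`, `Y`
be Polish spaces, `μ`, `ν` Borel probability measures, `c : X × Y → ℝ` bounded continuous,
`f : X → ℝ` bounded measurable. If a coupling `γ` of `(μ, ν)` is concentrated on the
`c`-subdifferential `∂_c f = {(x,y) | ∀ z, f z − f x ≥ c (z,y) − c (x,y)}`, then `γ` is an
optimal `c`-coupling: `∫ c dγ' ≤ ∫ c dγ` for every coupling `γ'` of `(μ, ν)`. -/
theorem stmt_18 {X Y : Type*}
    [TopologicalSpace X] [PolishSpace X] [MeasurableSpace X] [BorelSpace X]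
    [TopologicalSpace Y] [PolishSpace Y] [MeasurableSpace Y] [BorelSpace Y]
    (μ : Measure X) (ν : Measure Y) [IsProbabilityMeasure μ] [IsProbabilityMeasure ν]
    (c : X × Y → ℝ) (hc : Continuous c) (hcb : ∃ B, ∀ p, |c p| ≤ B)
    (f : X → ℝ) (hf : Measurable f) (hfb : ∃ B, ∀ x, |f x| ≤ B)
    (γ : Measure (X × Y)) (hγP : IsProbabilityMeasure γ)
    (hγ₁ : γ.map Prod.fst = μ) (hγ₂ : γ.map Prod.snd = ν)
    (hconc : γ {p : X × Y | ∀ z, c (z, p.2) - c (p.1, p.2) ≤ f z - f p.1} = 1) :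
    ∀ γ' : Measure (X × Y), IsProbabilityMeasure γ' →
      γ'.map Prod.fst = μ → γ'.map Prod.snd = ν →
      ∫ p, c p ∂γ' ≤ ∫ p, c p ∂γ := by
  obtain ⟨B, hB⟩ := hcb
  obtain ⟨A, hA⟩ := hfb
  intro γ' hγ'P hγ'₁ hγ'₂
  have : Nonempty X := nonempty_of_isProbabilityMeasure μ
  have hbdd : ∀ y, BddAbove (Set.range fun z => c (z, y) - f z) := fun y =>
    ⟨B + A, by
      rintro _ ⟨z, rfl⟩
      linarith [abs_le.1 (hB (z, y)), abs_le.1 (hA z)]⟩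
  set g : Y → ℝ := fun y => ⨆ z, (c (z, y) - f z)
  have hg : Measurable g := measurable_iSup_sub_of_continuous hc hbdd
  have hle : ∀ x y, c (x, y) - f x ≤ g y := fun x y => le_ciSup (hbdd y) x
  have hgb : ∀ y, |g y| ≤ B + A := fun y => by
    obtain ⟨x⟩ := ‹Nonempty X›
    refine abs_le.2 ⟨?_, ciSup_le fun z => ?_⟩
    · linarith [abs_le.1 (hB (x, y)), abs_le.1 (hA x), hle x y]
    · linarith [abs_le.1 (hB (z, y)), abs_le.1 (hA z)]
  have hfi : Integrable f μ := .of_bound hf.aestronglyMeasurable A (.of_forall hA)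
  have hgi : Integrable g ν := .of_bound hg.aestronglyMeasurable (B + A) (.of_forall hgb)
  have hset : {p : X × Y | ∀ z, c (z, p.2) - c (p.1, p.2) ≤ f z - f p.1}
      = {p : X × Y | f p.1 + g p.2 ≤ c p} := by
    ext ⟨x, y⟩
    refine ⟨fun h => ?_, fun h z => ?_⟩
    · have : g y ≤ c (x, y) - f x := ciSup_le fun z => by
        have := h z
        dsimp only at this
        linarith
      change f x + g y ≤ c (x, y)
      linarith
    · have h' : f x + g y ≤ c (x, y) := h
      change c (z, y) - c (x, y) ≤ f z - f x
      linarith [hle z y]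
  have hsum : Measurable fun p : X × Y => f p.1 + g p.2 := by fun_prop
  have hae : ∀ᵐ p ∂γ, f p.1 + g p.2 ≤ c p := by
    rw [hset] at hconc
    exact (mem_ae_iff_prob_eq_one (measurableSet_le hsum hc.measurable)).2 hconc
  have hci : ∀ (η : Measure (X × Y)) [IsProbabilityMeasure η], Integrable c η := fun η _ =>
    .of_bound hc.measurable.aestronglyMeasurable B (.of_forall hB)
  have hsi : ∀ (η : Measure (X × Y)), η.map Prod.fst = μ → η.map Prod.snd = ν →
      Integrable (fun p : X × Y => f p.1 + g p.2) η := fun η h₁ h₂ =>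
    ((h₁ ▸ hfi).comp_measurable measurable_fst).add ((h₂ ▸ hgi).comp_measurable measurable_snd)
  have hval : ∀ (η : Measure (X × Y)), η.map Prod.fst = μ → η.map Prod.snd = ν →
      ∫ p, (f p.1 + g p.2) ∂η = ∫ x, f x ∂μ + ∫ y, g y ∂ν := fun η h₁ h₂ => by
    rw [integral_fst_add_snd η (h₁ ▸ hfi) (h₂ ▸ hgi), h₁, h₂]
  calc ∫ p, c p ∂γ' ≤ ∫ p, (f p.1 + g p.2) ∂γ' :=
        integral_mono (hci γ') (hsi γ' hγ'₁ hγ'₂) fun p => by linarith [hle p.1 p.2]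
    _ = ∫ p, (f p.1 + g p.2) ∂γ := by rw [hval γ' hγ'₁ hγ'₂, hval γ hγ₁ hγ₂]
    _ ≤ ∫ p, c p ∂γ := integral_mono_ae (hsi γ hγ₁ hγ₂) (hci γ) hae
end

section
/- Sklar's theorem in dimension two: let H be a Borel probability measure on ℝ² with joint distribution function F(x,y) = H((-∞,x] × (-∞,y]) and marginal distribution functions F₁, F₂. Then there exists a copula measure γ on [0,1]² such that for all (x,y) ∈ ℝ², F(x,y) = C(F₁(x), F₂(y)), where C(u,v) = γ([0,u] × [0,v]) is the bivariate distribution function of γ. -/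
open MeasureTheory

open ProbabilityTheory Set Filter Topology

/-- The `u`-quantile of a measure on the line: the generalised inverse of its cdf. -/
noncomputable def quantile (μ : Measure ℝ) (u : ℝ) : ℝ := sInf {x | u ≤ cdf μ x}

/-- The quantile function and the cdf form a Galois connection on `(0,1)`. -/
theorem quantile_le_iff (μ : Measure ℝ) {u : ℝ} (hu : u ∈ Ioo (0 : ℝ) 1) (x : ℝ) :
    quantile μ u ≤ x ↔ u ≤ cdf μ x := by
  have hbdd : BddBelow {x | u ≤ cdf μ x} := by
    obtain ⟨b, hb⟩ := ((tendsto_cdf_atBot μ).eventually_lt_const hu.1).exists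
    exact ⟨b, fun y hy => (monotone_cdf μ).reflect_lt (hb.trans_le hy) |>.le⟩
  have hne : {x | u ≤ cdf μ x}.Nonempty := by
    obtain ⟨b, hb⟩ := ((tendsto_cdf_atTop μ).eventually_const_lt hu.2).exists
    exact ⟨b, hb.le⟩
  refine ⟨fun h => ?_, fun h => csInf_le hbdd h⟩
  refine le_trans ?_ (monotone_cdf μ h)
  refine ge_of_tendsto (((cdf μ).right_continuous (quantile μ u)).mono Ioi_subset_Ici_self) ?_
  filter_upwards [self_mem_nhdsWithin] with y hy
  obtain ⟨z, hz, hzy⟩ := exists_lt_of_csInf_lt hne hy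
  exact le_trans hz (monotone_cdf μ hzy.le)

theorem unif_eq_restrict_Ioo : unif = volume.restrict (Ioo (0 : ℝ) 1) :=
  (Measure.restrict_congr_set Ioo_ae_eq_Icc).symm

instance isProbabilityMeasure_unif_s19 : IsProbabilityMeasure unif :=
  ⟨by simp [unif]⟩

theorem ae_unif_mem_Ioo : ∀ᵐ u ∂unif, u ∈ Ioo (0 : ℝ) 1 := by
  rw [unif_eq_restrict_Ioo]
  exact ae_restrict_mem measurableSet_Ioo

theorem aemeasurable_quantile (μ : Measure ℝ) : AEMeasurable (quantile μ) unif := by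
  rw [unif_eq_restrict_Ioo]
  refine aemeasurable_restrict_of_monotoneOn measurableSet_Ioo fun u hu v hv huv => ?_
  exact (quantile_le_iff μ hu _).2 (huv.trans ((quantile_le_iff μ hv _).1 le_rfl))

theorem ae_quantile_le_iff (μ : Measure ℝ) (x : ℝ) :
    ∀ᵐ u ∂unif, quantile μ u ≤ x ↔ u ∈ Icc 0 (cdf μ x) := by
  filter_upwards [ae_unif_mem_Ioo] with u hu
  rw [quantile_le_iff μ hu, mem_Icc, and_iff_right hu.1.le]

/-- Inverse transform sampling. -/
theorem map_quantile_unif (μ : Measure ℝ) [IsProbabilityMeasure μ] :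
    unif.map (quantile μ) = μ := by
  have := Measure.isProbabilityMeasure_map (aemeasurable_quantile μ)
  refine Measure.ext_of_Iic _ _ fun x => ?_
  rw [Measure.map_apply_of_aemeasurable (aemeasurable_quantile μ) measurableSet_Iic,
    measure_congr (s := quantile μ ⁻¹' Iic x) (t := Icc 0 (cdf μ x))
      (eventuallyEq_set.2 (ae_quantile_le_iff μ x)), unif,
    Measure.restrict_apply measurableSet_Icc,
    inter_eq_left.2 (Icc_subset_Icc_right (cdf_le_one μ x)), Real.volume_Icc, sub_zero,
    ofReal_cdf]

/-- Every probability measure `μ` on the line has a coupling with the uniform measure under which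
`{s ≤ x}` and `{0 ≤ u ≤ cdf μ x}` agree almost surely. -/
theorem exists_coupling_unif (μ : Measure ℝ) [IsProbabilityMeasure μ] :
    ∃ ρ : Measure (ℝ × ℝ), IsProbabilityMeasure ρ ∧ ρ.fst = μ ∧ ρ.snd = unif ∧
      ∀ x, ∀ᵐ p ∂ρ, p.1 ≤ x ↔ p.2 ∈ Icc 0 (cdf μ x) := by
  have hQ := aemeasurable_quantile μ
  have hm : AEMeasurable (fun u => (quantile μ u, u)) unif := hQ.prodMk aemeasurable_id'
  refine ⟨unif.map fun u => (quantile μ u, u), Measure.isProbabilityMeasure_map hm, ?_, ?_,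
    fun x => ?_⟩
  · rw [Measure.fst_map_prodMk₀ aemeasurable_id', map_quantile_unif]
  · rw [Measure.snd_map_prodMk₀ hQ, Measure.map_id']
  · rw [ae_map_iff hm]
    · exact ae_quantile_le_iff μ x
    · exact (measurableSet_le measurable_fst measurable_const).iff
        (measurable_snd measurableSet_Icc)

/-- Gluing: a coupling of the law of `X` with a law on `γ` can be realised on an extension of the
probability space on which `X` is defined. -/
theorem exists_extension_of_coupling {Ω α γ : Type*} [MeasurableSpace Ω] [MeasurableSpace α]
    [MeasurableSpace γ] [StandardBorelSpace γ] [Nonempty γ] (P : Measure Ω)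
    [IsProbabilityMeasure P] {X : Ω → α} (hX : Measurable X) (ρ : Measure (α × γ))
    [IsProbabilityMeasure ρ] (h : ρ.fst = P.map X) :
    ∃ P' : Measure (Ω × γ), IsProbabilityMeasure P' ∧ P'.fst = P ∧
      P'.map (fun p => (X p.1, p.2)) = ρ := by
  refine ⟨P ⊗ₘ ρ.condKernel.comap X hX, inferInstance, Measure.fst_compProd _ _, ?_⟩
  have hm : Measurable fun p : Ω × γ => (X p.1, p.2) := by fun_prop
  ext s hs
  conv_rhs => rw [← ρ.disintegrate ρ.condKernel, h]
  rw [Measure.map_apply hm hs, Measure.compProd_apply (hm hs), Measure.compProd_apply hs,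
    lintegral_map (Kernel.measurable_kernel_prodMk_left hs) hX]
  rfl

/-- **Sklar's theorem in dimension two.** For every Borel probability measure `H` on `ℝ²`
with joint distribution function `F (x, y) = H ((-∞,x] × (-∞,y])` and marginal
distribution functions `F₁ (x) = H ((-∞,x] × ℝ)`, `F₂ (y) = H (ℝ × (-∞,y])`, there exists
a copula measure `γ` (with distribution function `C (u, v) = γ ([0,u] × [0,v])`) such that
`F (x, y) = C (F₁ x, F₂ y)` for all `(x, y) ∈ ℝ²`. -/
theorem stmt_19 (H : Measure (ℝ × ℝ)) [IsProbabilityMeasure H] :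
    ∃ γ : Measure (ℝ × ℝ), IsCopula γ ∧ ∀ x y : ℝ,
      H (Set.Iic x ×ˢ Set.Iic y)
        = γ (Set.Icc 0 ((H (Set.Iic x ×ˢ Set.univ)).toReal) ×ˢ
              Set.Icc 0 ((H (Set.univ ×ˢ Set.Iic y)).toReal)) := by
  obtain ⟨ρ₁, _, hfst₁, hsnd₁, hρ₁⟩ := exists_coupling_unif H.fst
  obtain ⟨ρ₂, _, hfst₂, hsnd₂, hρ₂⟩ := exists_coupling_unif H.snd
  obtain ⟨P, _, hPH, hPρ⟩ := exists_extension_of_coupling H measurable_fst ρ₁ hfst₁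
  have hX : Measurable fun p : (ℝ × ℝ) × ℝ => p.1.2 := by fun_prop
  obtain ⟨G, _, hGP, hGρ⟩ := exists_extension_of_coupling P hX ρ₂ (by
    rw [hfst₂, ← hPH, Measure.fst, Measure.snd, Measure.map_map measurable_snd measurable_fst]
    rfl)
  have hm₁ : Measurable fun p : ((ℝ × ℝ) × ℝ) × ℝ => (p.1.1.1, p.1.2) := by fun_prop
  have hm₂ : Measurable fun p : ((ℝ × ℝ) × ℝ) × ℝ => (p.1.1.2, p.2) := by fun_prop
  have hmU : Measurable fun p : ((ℝ × ℝ) × ℝ) × ℝ => (p.1.2, p.2) := by fun_prop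
  have hmH : Measurable fun p : ((ℝ × ℝ) × ℝ) × ℝ => p.1.1 := by fun_prop
  have hG₁ : G.map (fun p => (p.1.1.1, p.1.2)) = ρ₁ := by
    rw [← hPρ, ← hGP, Measure.fst, Measure.map_map (by fun_prop) measurable_fst]
    rfl
  have hGH : G.map (fun p => p.1.1) = H := by
    rw [← hPH, ← hGP, Measure.fst, Measure.fst, Measure.map_map measurable_fst measurable_fst]
    rfl
  refine ⟨G.map fun p => (p.1.2, p.2),
    ⟨Measure.isProbabilityMeasure_map hmU.aemeasurable, ?_, ?_⟩, fun x y => ?_⟩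
  · rw [← hsnd₁, ← hG₁, Measure.snd, Measure.map_map measurable_fst hmU,
      Measure.map_map measurable_snd hm₁]
    rfl
  · rw [← hsnd₂, ← hGρ, Measure.snd, Measure.map_map measurable_snd hmU,
      Measure.map_map measurable_snd hm₂]
    rfl
  · have hF₁ : (H (Iic x ×ˢ univ)).toReal = cdf H.fst x := by
      rw [cdf_eq_real, measureReal_def, Measure.fst_apply measurableSet_Iic, prod_univ]
    have hF₂ : (H (univ ×ˢ Iic y)).toReal = cdf H.snd y := by
      rw [cdf_eq_real, measureReal_def, Measure.snd_apply measurableSet_Iic, univ_prod]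
    rw [hF₁, hF₂, Measure.map_apply hmU (measurableSet_Icc.prod measurableSet_Icc)]
    conv_lhs => rw [← hGH, Measure.map_apply hmH (measurableSet_Iic.prod measurableSet_Iic)]
    have h₁ := ae_of_ae_map hm₁.aemeasurable (hG₁ ▸ hρ₁ x)
    have h₂ := ae_of_ae_map hm₂.aemeasurable (hGρ ▸ hρ₂ y)
    refine measure_congr (eventuallyEq_set.2 ?_)
    filter_upwards [h₁, h₂] with p hp₁ hp₂
    exact and_congr hp₁ hp₂
end
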